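/- Let W₁, …, W_r be degree one quantum GWAs over a field k with canonical generators x_i, y_i, t_i and parameters (q_i, h_i), where each q_i ∈ k is a root of unity with q_i² ≠ 1 and each h_i ∈ k[t] has degree at least 2. Let A = W₁ ⊗_k ⋯ ⊗_k W_r and let ι_i : W_i → A denote the canonical embeddings. Then for every k-algebra automorphism φ of A there exists a permutation τ of {1,…,r} such that: (1) φ(ι_i(W_i)) = ι_{τ(i)}(W_{τ(i)}) for all i; and (2) there exist scalars α_i, β_i, γ_i ∈ k^× and signs ε_i ∈ {±1} such that φ(ι_i(t_i)) = γ_i·ι_{τ(i)}(t_{τ(i)}) and, if ε_i = 1, φ(ι_i(x_i)) = α_i·ι_{τ(i)}(x_{τ(i)}), φ(ι_i(y_i)) = β_i·ι_{τ(i)}(y_{τ(i)}), and h_i(γ_i t) = α_iβ_i·h_{τ(i)}(t) in k[t], while if ε_i = −1, φ(ι_i(x_i)) = α_i·ι_{τ(i)}(y_{τ(i)}), φ(ι_i(y_i)) = β_i·ι_{τ(i)}(x_{τ(i)}), and h_i(γ_i t) = α_iβ_i·h_{τ(i)}(q_{τ(i)}⁻¹ t) in k[t]. -/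

import Mathlib

/-- Generators of the degree `m` quantum generalized Weyl algebra:
`x i`, `y i` for `i : Fin m`, and `t`. -/
inductive GWAGen (m : ℕ) : Type
  | x : Fin m → GWAGen m
  | y : Fin m → GWAGen m
  | t : GWAGen m

/-- The defining relations of the degree `m` quantum generalized Weyl algebra over `k`
with parameters `q : Fin m → k` and `h : Fin m → k[X]`:
`xᵢt = qᵢ·txᵢ`, `yᵢt = qᵢ⁻¹·tyᵢ`, `xᵢyᵢ = hᵢ(t)`, `yᵢxᵢ = hᵢ(qᵢ⁻¹t)`, and
`xᵢ`, `yᵢ` commute with `xⱼ`, `yⱼ` for `i ≠ j`. -/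
inductive GWARel (k : Type*) [Field k] (m : ℕ) (q : Fin m → k) (h : Fin m → Polynomial k) :
    FreeAlgebra k (GWAGen m) → FreeAlgebra k (GWAGen m) → Prop
  | xt (i : Fin m) : GWARel k m q h
      (FreeAlgebra.ι k (GWAGen.x i) * FreeAlgebra.ι k GWAGen.t)
      (q i • (FreeAlgebra.ι k GWAGen.t * FreeAlgebra.ι k (GWAGen.x i)))
  | yt (i : Fin m) : GWARel k m q h
      (FreeAlgebra.ι k (GWAGen.y i) * FreeAlgebra.ι k GWAGen.t)
      ((q i)⁻¹ • (FreeAlgebra.ι k GWAGen.t * FreeAlgebra.ι k (GWAGen.y i)))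
  | xy (i : Fin m) : GWARel k m q h
      (FreeAlgebra.ι k (GWAGen.x i) * FreeAlgebra.ι k (GWAGen.y i))
      (Polynomial.aeval (FreeAlgebra.ι k GWAGen.t) (h i))
  | yx (i : Fin m) : GWARel k m q h
      (FreeAlgebra.ι k (GWAGen.y i) * FreeAlgebra.ι k (GWAGen.x i))
      (Polynomial.aeval ((q i)⁻¹ • FreeAlgebra.ι k GWAGen.t) (h i))
  | xx (i j : Fin m) (hij : i ≠ j) : GWARel k m q h
      (FreeAlgebra.ι k (GWAGen.x i) * FreeAlgebra.ι k (GWAGen.x j))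
      (FreeAlgebra.ι k (GWAGen.x j) * FreeAlgebra.ι k (GWAGen.x i))
  | yy (i j : Fin m) (hij : i ≠ j) : GWARel k m q h
      (FreeAlgebra.ι k (GWAGen.y i) * FreeAlgebra.ι k (GWAGen.y j))
      (FreeAlgebra.ι k (GWAGen.y j) * FreeAlgebra.ι k (GWAGen.y i))
  | xyc (i j : Fin m) (hij : i ≠ j) : GWARel k m q h
      (FreeAlgebra.ι k (GWAGen.x i) * FreeAlgebra.ι k (GWAGen.y j))
      (FreeAlgebra.ι k (GWAGen.y j) * FreeAlgebra.ι k (GWAGen.x i))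

/-- The degree `m` quantum generalized Weyl algebra `k[t](x, y, σ, h)` with `σᵢ(t) = qᵢt`:
the quotient of the free algebra on the generators by the two-sided ideal generated by
the defining relations. -/
abbrev GWA (k : Type*) [Field k] (m : ℕ) (q : Fin m → k) (h : Fin m → Polynomial k) : Type _ :=
  RingQuot (GWARel k m q h)

variable {k : Type*} [Field k] {m : ℕ} {q : Fin m → k} {h : Fin m → Polynomial k}

/-- The generator `xᵢ` of the quantum GWA. -/
noncomputable def GWA.x (i : Fin m) : GWA k m q h :=
  RingQuot.mkAlgHom k (GWARel k m q h) (FreeAlgebra.ι k (GWAGen.x i))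

/-- The generator `yᵢ` of the quantum GWA. -/
noncomputable def GWA.y (i : Fin m) : GWA k m q h :=
  RingQuot.mkAlgHom k (GWARel k m q h) (FreeAlgebra.ι k (GWAGen.y i))

/-- The generator `t` of the quantum GWA. -/
noncomputable def GWA.t : GWA k m q h :=
  RingQuot.mkAlgHom k (GWARel k m q h) (FreeAlgebra.ι k GWAGen.t)

/-- The quantum GWA is an algebra over its center. -/
noncomputable instance GWA.algebraCenter :
    Algebra (Subalgebra.center k (GWA k m q h)) (GWA k m q h) :=
  RingHom.toAlgebra' (Subalgebra.center k (GWA k m q h)).val.toRingHom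
    (fun c x => by
      have := Subalgebra.mem_center_iff.mp c.2 x
      simpa using this.symm)

open scoped TensorProduct
open Polynomial

/-- The canonical embedding of the `i`-th factor into the tensor product
`A = W₁ ⊗ₖ ⋯ ⊗ₖ W_r` of degree one quantum GWAs: `w ↦ 1 ⊗ ⋯ ⊗ w ⊗ ⋯ ⊗ 1`. -/
noncomputable def gwaTensorEmb {k : Type*} [Field k] {r : ℕ}
    (Q : Fin r → k) (H : Fin r → Polynomial k) (i : Fin r)
    (w : GWA k 1 (fun _ => Q i) (fun _ => H i)) :
    ⨂[k] j : Fin r, GWA k 1 (fun _ => Q j) (fun _ => H j) :=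
  PiTensorProduct.tprod k
    (Function.update (fun j => (1 : GWA k 1 (fun _ => Q j) (fun _ => H j))) i w)

/-! ### Twisted group algebras -/

/-- A bicharacter of the additive group `G` with nonzero values in `k`. -/
structure Bicharacter (k G : Type*) [Field k] [AddCommGroup G] where
  toFun : G → G → k
  add_left : ∀ a b c, toFun (a + b) c = toFun a c * toFun b c
  add_right : ∀ a b c, toFun a (b + c) = toFun a b * toFun a c
  ne_zero : ∀ a b, toFun a b ≠ 0

/-- The twisted group algebra with basis indexed by `G` and multiplication
`e_a e_b = χ(a, b) e_{a + b}`. -/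
def TwistedAlgebra {G : Type*} [AddCommGroup G] (_χ : Bicharacter k G) : Type _ := G →₀ k

namespace TwistedAlgebra

variable {G : Type*} [AddCommGroup G] {χ : Bicharacter k G}

theorem bichar_zero_left (χ : Bicharacter k G) (a : G) : χ.toFun 0 a = 1 := by
  have h1 := χ.add_left 0 0 a
  rw [add_zero] at h1
  exact (mul_eq_left₀ (χ.ne_zero 0 a)).mp h1.symm

theorem bichar_zero_right (χ : Bicharacter k G) (a : G) : χ.toFun a 0 = 1 := by
  have h1 := χ.add_right a 0 0
  rw [add_zero] at h1
  exact (mul_eq_left₀ (χ.ne_zero a 0)).mp h1.symm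

noncomputable instance : AddCommGroup (TwistedAlgebra χ) := inferInstanceAs (AddCommGroup (G →₀ k))

noncomputable instance : Module k (TwistedAlgebra χ) := inferInstanceAs (Module k (G →₀ k))

variable (χ) in
/-- The defining basis of the twisted group algebra. -/
noncomputable def basis : Module.Basis G k (TwistedAlgebra χ) :=
  Module.Basis.ofRepr (LinearEquiv.refl k (G →₀ k))

variable (χ) in
/-- The multiplication as a bilinear map. -/
noncomputable def mulLin : TwistedAlgebra χ →ₗ[k] TwistedAlgebra χ →ₗ[k] TwistedAlgebra χ :=
  (basis χ).constr k fun a => (basis χ).constr k fun b => χ.toFun a b • basis χ (a + b)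

theorem mulLin_basis (a b : G) :
    mulLin χ (basis χ a) (basis χ b) = χ.toFun a b • basis χ (a + b) := by
  simp [mulLin, Module.Basis.constr_basis]


theorem induction_basis {p : TwistedAlgebra χ → Prop} (u : TwistedAlgebra χ)
    (basis : ∀ g, p (basis χ g)) (zero : p 0) (add : ∀ u v, p u → p v → p (u + v))
    (smul : ∀ (c : k) u, p u → p (c • u)) : p u :=
  Submodule.span_induction (p := fun u _ => p u) (by rintro _ ⟨g, rfl⟩; exact basis g) zero
    (fun u v _ _ => add u v) (fun c u _ => smul c u)
    ((TwistedAlgebra.basis χ).mem_span u)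

theorem mulLin_assoc (u v w : TwistedAlgebra χ) :
    mulLin χ (mulLin χ u v) w = mulLin χ u (mulLin χ v w) := by
  induction u using induction_basis with
  | zero => simp
  | add u u' hu hu' => simp [hu, hu']
  | smul c u hu => simp [hu]
  | basis a =>
  induction v using induction_basis with
  | zero => simp
  | add u u' hu hu' => simp [hu, hu']
  | smul c u hu => simp [hu]
  | basis b =>
  induction w using induction_basis with
  | zero => simp
  | add u u' hu hu' => simp [hu, hu']
  | smul c u hu => simp [hu]
  | basis c =>
  simp only [mulLin_basis, map_smul, LinearMap.smul_apply, smul_smul, χ.add_left, χ.add_right,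
    add_assoc]
  congr 1
  ring

theorem one_mulLin (u : TwistedAlgebra χ) : mulLin χ (basis χ 0) u = u := by
  induction u using induction_basis with
  | zero => simp
  | add u u' hu hu' => simp [hu, hu']
  | smul c u hu => simp [hu]
  | basis a => simp [mulLin_basis, bichar_zero_left]

theorem mulLin_one (u : TwistedAlgebra χ) : mulLin χ u (basis χ 0) = u := by
  induction u using induction_basis with
  | zero => simp
  | add u u' hu hu' => simp [hu, hu']
  | smul c u hu => simp [hu]
  | basis a => simp [mulLin_basis, bichar_zero_right]

noncomputable instance : Ring (TwistedAlgebra χ) where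
  __ := (inferInstance : AddCommGroup (TwistedAlgebra χ))
  mul u v := mulLin χ u v
  one := basis χ 0
  left_distrib u v w := map_add (mulLin χ u) v w
  right_distrib u v w := LinearMap.map_add₂ (mulLin χ) u v w
  zero_mul u := LinearMap.map_zero₂ (mulLin χ) u
  mul_zero u := map_zero (mulLin χ u)
  mul_assoc := mulLin_assoc
  one_mul := one_mulLin
  mul_one := mulLin_one

noncomputable instance : Algebra k (TwistedAlgebra χ) :=
  Algebra.ofModule (fun c u v => LinearMap.map_smul₂ (mulLin χ) c u v)
    (fun c u v => map_smul (mulLin χ u) c v)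

theorem basis_mul_basis (a b : G) :
    basis χ a * basis χ b = χ.toFun a b • basis χ (a + b) := mulLin_basis a b

theorem basis_zero : basis χ 0 = 1 := rfl

/-- The span of the basis elements indexed by `S`. -/
noncomputable def supported (χ : Bicharacter k G) (S : Set G) : Submodule k (TwistedAlgebra χ) :=
  Submodule.span k (basis χ '' S)

theorem mem_supported {S : Set G} {u : TwistedAlgebra χ} :
    u ∈ supported χ S ↔ ∀ g, (basis χ).repr u g ≠ 0 → g ∈ S := by
  rw [supported, Module.Basis.mem_span_image]
  simp [Set.subset_def]

theorem basis_mem_supported {S : Set G} {g : G} (hg : g ∈ S) : basis χ g ∈ supported χ S :=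
  Submodule.subset_span ⟨g, hg, rfl⟩

theorem supported_mono {S T : Set G} (hST : S ⊆ T) : supported χ S ≤ supported χ T :=
  Submodule.span_mono (Set.image_mono hST)

@[elab_as_elim]
theorem supported_induction {S : Set G} {p : (u : TwistedAlgebra χ) → u ∈ supported χ S → Prop}
    (basis : ∀ g (hg : g ∈ S), p (basis χ g) (basis_mem_supported hg))
    (zero : p 0 (zero_mem _))
    (add : ∀ u v hu hv, p u hu → p v hv → p (u + v) (add_mem hu hv))
    (smul : ∀ (c : k) u hu, p u hu → p (c • u) (Submodule.smul_mem _ c hu))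
    {u : TwistedAlgebra χ} (hu : u ∈ supported χ S) : p u hu :=
  Submodule.span_induction (p := p) (by rintro _ ⟨g, hg, rfl⟩; exact basis g hg) zero add smul hu

theorem mul_mem_supported {S T U : Set G} (hU : ∀ a ∈ S, ∀ b ∈ T, a + b ∈ U)
    {u v : TwistedAlgebra χ} (hu : u ∈ supported χ S) (hv : v ∈ supported χ T) :
    u * v ∈ supported χ U := by
  induction hu using supported_induction with
  | zero => simp
  | add u u' _ _ hu hu' => rw [add_mul]; exact add_mem hu hu'
  | smul c u _ hu => rw [smul_mul_assoc]; exact Submodule.smul_mem _ _ hu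
  | basis a ha =>
  induction hv using supported_induction with
  | zero => simp
  | add u u' _ _ hu hu' => rw [mul_add]; exact add_mem hu hu'
  | smul c u _ hu => rw [mul_smul_comm]; exact Submodule.smul_mem _ _ hu
  | basis b hb =>
    rw [basis_mul_basis]
    exact Submodule.smul_mem _ _ (basis_mem_supported (hU a ha b hb))

open Classical in
/-- The projection onto the span of the basis elements indexed by `S`. -/
noncomputable def proj (χ : Bicharacter k G) (S : Set G) :
    TwistedAlgebra χ →ₗ[k] TwistedAlgebra χ :=
  (basis χ).constr k fun g => if g ∈ S then basis χ g else 0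

open Classical in
theorem proj_basis (S : Set G) (g : G) :
    proj χ S (basis χ g) = if g ∈ S then basis χ g else 0 := by
  simp [proj, Module.Basis.constr_basis]

open Classical in
theorem repr_proj (S : Set G) (u : TwistedAlgebra χ) (g : G) :
    (basis χ).repr (proj χ S u) g = if g ∈ S then (basis χ).repr u g else 0 := by
  induction u using induction_basis with
  | zero => simp
  | add u u' hu hu' => simp only [map_add, Finsupp.add_apply, hu, hu']; split_ifs <;> simp
  | smul c u hu => simp only [map_smul, Finsupp.smul_apply, hu]; split_ifs <;> simp
  | basis a =>
    rw [proj_basis]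
    by_cases ha : a ∈ S <;> by_cases hg : g ∈ S <;>
      simp only [ha, hg, if_true, if_false, map_zero, Finsupp.zero_apply,
        Module.Basis.repr_self]
    · rw [Finsupp.single_eq_of_ne (by rintro rfl; exact hg ha)]
    · rw [Finsupp.single_eq_of_ne (by rintro rfl; exact ha hg)]

theorem proj_mem (S : Set G) (u : TwistedAlgebra χ) : proj χ S u ∈ supported χ S := by
  classical
  rw [mem_supported]
  intro g hg
  rw [repr_proj] at hg
  by_contra hS
  simp [hS] at hg

theorem proj_eq_self {S : Set G} {u : TwistedAlgebra χ} (hu : u ∈ supported χ S) :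
    proj χ S u = u := by
  classical
  refine (basis χ).repr.injective (Finsupp.ext fun g => ?_)
  rw [repr_proj]
  by_cases hg : g ∈ S
  · simp [hg]
  · by_contra h0
    exact hg (mem_supported.1 hu g (by simpa [hg, eq_comm] using h0))

theorem proj_eq_zero {S T : Set G} (hST : Disjoint S T) {u : TwistedAlgebra χ}
    (hu : u ∈ supported χ T) : proj χ S u = 0 := by
  induction hu using supported_induction with
  | zero => simp
  | add u u' _ _ hu hu' => simp [hu, hu']
  | smul c u _ hu => simp [hu]
  | basis a ha =>
    rw [proj_basis, if_neg (fun h => Set.disjoint_left.1 hST h ha)]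

/-! #### Gradings and unique sums -/

section Grading

variable {S : Type*} [AddCommGroup S] (σ : G →+ S)

theorem sum_proj_eq {u : TwistedAlgebra χ} {A : Finset S}
    (hA : ∀ g, (basis χ).repr u g ≠ 0 → σ g ∈ A) :
    ∑ a ∈ A, proj χ (σ ⁻¹' {a}) u = u := by
  classical
  refine (basis χ).repr.injective (Finsupp.ext fun g => ?_)
  rw [map_sum, Finsupp.finsetSum_apply]
  simp only [repr_proj, Set.mem_preimage, Set.mem_singleton_iff]
  rw [Finset.sum_ite_eq]
  by_cases hg : σ g ∈ A
  · simp [hg]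
  · simp only [hg, if_false]
    by_contra h0
    exact hg (hA g (Ne.symm h0))

theorem mul_mem_supported_preimage {a b : S} {u v : TwistedAlgebra χ}
    (hu : u ∈ supported χ (σ ⁻¹' {a})) (hv : v ∈ supported χ (σ ⁻¹' {b})) :
    u * v ∈ supported χ (σ ⁻¹' {a + b}) :=
  mul_mem_supported (fun x hx y hy => by
    simp only [Set.mem_preimage, Set.mem_singleton_iff] at *; rw [map_add, hx, hy]) hu hv

theorem disjoint_preimage {a b : S} (hab : a ≠ b) :
    Disjoint (σ ⁻¹' {a}) (σ ⁻¹' {b}) :=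
  Disjoint.preimage _ (by simpa using hab)

theorem proj_mul_of_uniqueAdd {u v : TwistedAlgebra χ} {A B : Finset S}
    (hA : ∀ g, (basis χ).repr u g ≠ 0 → σ g ∈ A)
    (hB : ∀ g, (basis χ).repr v g ≠ 0 → σ g ∈ B) {a b : S} (ha : a ∈ A) (hb : b ∈ B)
    (hab : UniqueAdd A B a b) :
    proj χ (σ ⁻¹' {a + b}) (u * v) = proj χ (σ ⁻¹' {a}) u * proj χ (σ ⁻¹' {b}) v := by
  classical
  conv_lhs => rw [← sum_proj_eq σ hA, ← sum_proj_eq σ hB, Finset.sum_mul_sum, map_sum]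
  rw [Finset.sum_eq_single_of_mem a ha, map_sum, Finset.sum_eq_single_of_mem b hb]
  · exact proj_eq_self (mul_mem_supported_preimage σ (proj_mem _ _) (proj_mem _ _))
  · intro b' hb' hne
    refine proj_eq_zero (disjoint_preimage σ ?_)
      (mul_mem_supported_preimage σ (proj_mem _ _) (proj_mem _ _))
    exact fun h => hne (add_left_cancel h).symm
  · intro a' ha' hne
    rw [map_sum]
    refine Finset.sum_eq_zero fun b' hb' => ?_
    refine proj_eq_zero (disjoint_preimage σ ?_)
      (mul_mem_supported_preimage σ (proj_mem _ _) (proj_mem _ _))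
    exact fun h => hne (hab ha' hb' h.symm).1

theorem proj_id_singleton (u : TwistedAlgebra χ) (g : G) :
    proj χ (AddMonoidHom.id G ⁻¹' {g}) u = (basis χ).repr u g • basis χ g := by
  classical
  refine (basis χ).repr.injective (Finsupp.ext fun x => ?_)
  rw [repr_proj]
  by_cases hx : x = g
  · subst hx; simp
  · simp [hx]

open Classical in
/-- The set of degrees of an element. -/
noncomputable def degrees (u : TwistedAlgebra χ) : Finset S :=
  ((basis χ).repr u).support.image σ

theorem mem_degrees {u : TwistedAlgebra χ} {a : S} :
    a ∈ degrees σ u ↔ ∃ g, (basis χ).repr u g ≠ 0 ∧ σ g = a := by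
  simp [degrees]

theorem proj_ne_zero {u : TwistedAlgebra χ} {a : S} (ha : a ∈ degrees σ u) :
    proj χ (σ ⁻¹' {a}) u ≠ 0 := by
  classical
  obtain ⟨g, hg, hga⟩ := (mem_degrees σ).1 ha
  intro h0
  apply hg
  have := repr_proj (σ ⁻¹' {a}) u g
  rw [h0] at this
  simpa [hga] using this.symm

theorem degrees_nonempty {u : TwistedAlgebra χ} (hu : u ≠ 0) : (degrees σ u).Nonempty := by
  classical
  rw [degrees, Finset.image_nonempty, Finsupp.support_nonempty_iff]
  simpa using hu

theorem smul_basis_mul_ne_zero {c d : k} (hc : c ≠ 0) (hd : d ≠ 0) (a b : G) :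
    (c • basis χ a) * (d • basis χ b) ≠ 0 := by
  rw [smul_mul_assoc, mul_smul_comm, basis_mul_basis]
  simp [hc, hd, χ.ne_zero, (basis χ).ne_zero]

instance [UniqueSums G] : NoZeroDivisors (TwistedAlgebra χ) where
  eq_zero_or_eq_zero_of_mul_eq_zero {u v} huv := by
    classical
    by_contra! hne
    obtain ⟨a, ha, b, hb, hab⟩ := UniqueSums.uniqueAdd_of_nonempty
      (degrees_nonempty (AddMonoidHom.id G) hne.1) (degrees_nonempty (AddMonoidHom.id G) hne.2)
    have h1 := proj_mul_of_uniqueAdd (AddMonoidHom.id G) (u := u) (v := v)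
      (fun g hg => (mem_degrees _).2 ⟨g, hg, rfl⟩)
      (fun g hg => (mem_degrees _).2 ⟨g, hg, rfl⟩) ha hb hab
    rw [huv, map_zero, proj_id_singleton, proj_id_singleton] at h1
    obtain ⟨g, hg, rfl⟩ := (mem_degrees _).1 ha
    obtain ⟨g', hg', rfl⟩ := (mem_degrees _).1 hb
    exact smul_basis_mul_ne_zero hg hg' _ _ h1.symm

instance : Nontrivial (TwistedAlgebra χ) := ⟨⟨basis χ 0, 0, (basis χ).ne_zero 0⟩⟩

variable [NoZeroDivisors (TwistedAlgebra χ)]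

theorem homogeneous_of_mul_homogeneous [TwoUniqueSums S] {u v : TwistedAlgebra χ} {c : S}
    (huv : u * v ∈ supported χ (σ ⁻¹' {c})) (hne : u * v ≠ 0) :
    ∃ a b, a + b = c ∧ u ∈ supported χ (σ ⁻¹' {a}) ∧ v ∈ supported χ (σ ⁻¹' {b}) := by
  classical
  have hu : u ≠ 0 := left_ne_zero_of_mul hne
  have hv : v ≠ 0 := right_ne_zero_of_mul hne
  have hA := degrees_nonempty σ hu
  have hB := degrees_nonempty σ hv
  have key : ∀ a ∈ degrees σ u, ∀ b ∈ degrees σ v,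
      UniqueAdd (degrees σ u) (degrees σ v) a b → a + b = c := by
    intro a ha b hb hab
    have h1 := proj_mul_of_uniqueAdd σ (u := u) (v := v)
      (fun g hg => (mem_degrees _).2 ⟨g, hg, rfl⟩)
      (fun g hg => (mem_degrees _).2 ⟨g, hg, rfl⟩) ha hb hab
    by_contra hc
    rw [proj_eq_zero (disjoint_preimage σ hc) huv] at h1
    exact mul_ne_zero (proj_ne_zero σ ha) (proj_ne_zero σ hb) h1.symm
  have hcard : (degrees σ u).card * (degrees σ v).card ≤ 1 := by
    by_contra! hlt
    obtain ⟨⟨a, b⟩, h1, ⟨a', b'⟩, h2, hne, hu1, hu2⟩ :=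
      TwoUniqueSums.uniqueAdd_of_one_lt_card hlt
    rw [Finset.mem_product] at h1 h2
    have e1 := key a h1.1 b h1.2 hu1
    have e2 := key a' h2.1 b' h2.2 hu2
    have := hu1 h2.1 h2.2 (e2.trans e1.symm)
    exact hne (Prod.ext this.1.symm this.2.symm)
  have c1 := Finset.card_pos.2 hA
  have c2 := Finset.card_pos.2 hB
  have d1 : (degrees σ u).card = 1 := by nlinarith
  have d2 : (degrees σ v).card = 1 := by nlinarith
  obtain ⟨a, ha⟩ := Finset.card_eq_one.1 d1
  obtain ⟨b, hb⟩ := Finset.card_eq_one.1 d2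
  refine ⟨a, b, ?_, ?_, ?_⟩
  · refine key a (by simp [ha]) b (by simp [hb]) ?_
    rw [ha, hb]
    intro x y hx hy _
    simp_all
  · rw [mem_supported]
    intro g hg
    have := (mem_degrees σ).2 ⟨g, hg, rfl⟩
    simpa [ha] using this
  · rw [mem_supported]
    intro g hg
    have := (mem_degrees σ).2 ⟨g, hg, rfl⟩
    simpa [hb] using this

theorem exists_repr_mul_ne_zero (l : G →+ ℤ) {u v : TwistedAlgebra χ} {a b : G}
    (ha : (basis χ).repr u a ≠ 0) (hb : (basis χ).repr v b ≠ 0) :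
    ∃ g, (basis χ).repr (u * v) g ≠ 0 ∧ l a + l b ≤ l g := by
  classical
  have hA : (degrees l u).Nonempty := ⟨l a, (mem_degrees l).2 ⟨a, ha, rfl⟩⟩
  have hB : (degrees l v).Nonempty := ⟨l b, (mem_degrees l).2 ⟨b, hb, rfl⟩⟩
  set M := (degrees l u).max' hA with hM
  set N := (degrees l v).max' hB with hN
  have hMm := Finset.max'_mem _ hA
  have hNm := Finset.max'_mem _ hB
  have h1 := proj_mul_of_uniqueAdd l (u := u) (v := v)
      (fun g hg => (mem_degrees _).2 ⟨g, hg, rfl⟩)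
      (fun g hg => (mem_degrees _).2 ⟨g, hg, rfl⟩) hMm hNm (by
        intro x y hx hy hxy
        have := Finset.le_max' _ _ hx
        have := Finset.le_max' _ _ hy
        constructor <;> omega)
  have h2 := mul_ne_zero (proj_ne_zero l hMm) (proj_ne_zero l hNm)
  rw [← h1] at h2
  have h3 : (basis χ).repr (proj χ (l ⁻¹' {M + N}) (u * v)) ≠ 0 := by simpa using h2
  obtain ⟨g, hg⟩ := Finsupp.ne_iff.1 h3
  rw [repr_proj] at hg
  by_cases hgl : g ∈ l ⁻¹' {M + N}
  · refine ⟨g, by simpa [hgl] using hg, ?_⟩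
    have e1 := Finset.le_max' _ _ ((mem_degrees l).2 ⟨a, ha, rfl⟩)
    have e2 := Finset.le_max' _ _ ((mem_degrees l).2 ⟨b, hb, rfl⟩)
    have e3 : l g = M + N := hgl
    omega
  · simp [hgl] at hg

end Grading

/-! #### The radical of the bicharacter and the center -/

variable (χ) in
/-- The set of group elements whose basis element is central. -/
def radical : Set G := {g | ∀ h, χ.toFun g h = χ.toFun h g}

theorem add_mem_radical {a b : G} (ha : a ∈ radical χ) (hb : b ∈ radical χ) :
    a + b ∈ radical χ := fun h => by
  rw [χ.add_left, χ.add_right, ha h, hb h]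

theorem add_mem_radical_iff {a b : G} (ha : a ∈ radical χ) :
    a + b ∈ radical χ ↔ b ∈ radical χ := by
  refine ⟨fun hab h => ?_, add_mem_radical ha⟩
  have := hab h
  rw [χ.add_left, χ.add_right, ha h] at this
  exact mul_left_cancel₀ (χ.ne_zero _ _) this

theorem bichar_eq_of_add_mem_radical {a b : G} (hab : a + b ∈ radical χ) :
    χ.toFun a b = χ.toFun b a := by
  have := hab b
  rw [χ.add_left, χ.add_right] at this
  exact mul_right_cancel₀ (χ.ne_zero b b) this

theorem commute_of_mem_supported_radical {z : TwistedAlgebra χ}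
    (hz : z ∈ supported χ (radical χ)) (u : TwistedAlgebra χ) : z * u = u * z := by
  induction hz using supported_induction with
  | zero => simp
  | add u u' _ _ hu hu' => rw [add_mul, mul_add, hu, hu']
  | smul c u _ hu => rw [smul_mul_assoc, mul_smul_comm, hu]
  | basis a ha =>
  induction u using induction_basis with
  | zero => simp
  | add u u' hu hu' => rw [add_mul, mul_add, hu, hu']
  | smul c u hu => rw [smul_mul_assoc, mul_smul_comm, hu]
  | basis b => rw [basis_mul_basis, basis_mul_basis, ha b, add_comm]

theorem repr_basis_mul (h g : G) (u : TwistedAlgebra χ) :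
    (basis χ).repr (basis χ h * u) (h + g) = χ.toFun h g * (basis χ).repr u g := by
  classical
  induction u using induction_basis with
  | zero => simp
  | add u u' hu hu' => simp only [mul_add, map_add, Finsupp.add_apply, hu, hu']
  | smul c u hu => simp only [mul_smul_comm, map_smul, Finsupp.smul_apply, hu, smul_eq_mul]; ring
  | basis b =>
    rw [basis_mul_basis]
    by_cases hb : b = g
    · subst hb; simp
    · simp [hb]

theorem repr_mul_basis (h g : G) (u : TwistedAlgebra χ) :
    (basis χ).repr (u * basis χ h) (h + g) = χ.toFun g h * (basis χ).repr u g := by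
  classical
  induction u using induction_basis with
  | zero => simp
  | add u u' hu hu' => simp only [add_mul, map_add, Finsupp.add_apply, hu, hu']; ring
  | smul c u hu => simp only [smul_mul_assoc, map_smul, Finsupp.smul_apply, hu, smul_eq_mul]; ring
  | basis b =>
    rw [basis_mul_basis]
    by_cases hb : b = g
    · subst hb; simp [add_comm]
    · simp [hb, add_comm b h]

theorem bichar_comm_of_commute {h g : G} {u : TwistedAlgebra χ}
    (hu : basis χ h * u = u * basis χ h) (hg : (basis χ).repr u g ≠ 0) :
    χ.toFun g h = χ.toFun h g := by
  have h1 := repr_basis_mul h g u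
  rw [hu, repr_mul_basis] at h1
  exact mul_right_cancel₀ hg h1

theorem proj_radical_mul_comm (u v : TwistedAlgebra χ) :
    proj χ (radical χ) (u * v) = proj χ (radical χ) (v * u) := by
  classical
  induction u using induction_basis with
  | zero => simp
  | add u u' hu hu' => simp only [add_mul, mul_add, map_add, hu, hu']
  | smul c u hu => simp only [smul_mul_assoc, mul_smul_comm, map_smul, hu]
  | basis a =>
  induction v using induction_basis with
  | zero => simp
  | add u u' hu hu' => simp only [add_mul, mul_add, map_add, hu, hu']
  | smul c u hu => simp only [smul_mul_assoc, mul_smul_comm, map_smul, hu]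
  | basis b =>
    rw [basis_mul_basis, basis_mul_basis, map_smul, map_smul, proj_basis, proj_basis, add_comm b a]
    split_ifs with hab
    · rw [bichar_eq_of_add_mem_radical hab]
    · simp

theorem proj_radical_mul {z : TwistedAlgebra χ}
    (hz : z ∈ supported χ (radical χ)) (u : TwistedAlgebra χ) :
    proj χ (radical χ) (z * u) = z * proj χ (radical χ) u := by
  classical
  induction hz using supported_induction with
  | zero => simp
  | add u u' _ _ hu hu' => simp only [add_mul, map_add, hu, hu']
  | smul c u _ hu => simp only [smul_mul_assoc, map_smul, hu]
  | basis a ha =>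
  induction u using induction_basis with
  | zero => simp
  | add u u' hu hu' => simp only [mul_add, map_add, hu, hu']
  | smul c u hu => simp only [mul_smul_comm, map_smul, hu]
  | basis b =>
    rw [basis_mul_basis, map_smul, proj_basis, proj_basis]
    simp only [add_mem_radical_iff ha]
    split_ifs
    · rw [basis_mul_basis]
    · simp

end TwistedAlgebra

/-! ### The rank one case -/

theorem mul_aeval_of_mul_eq {R : Type*} [Ring R] [Algebra k R] {a s s' : R}
    (hs : a * s = s' * a) (p : k[X]) : a * aeval s p = aeval s' p * a := by
  induction p using Polynomial.induction_on' with
  | add p p' hp hp' => simp only [map_add, mul_add, add_mul, hp, hp']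
  | monomial n c =>
    have hn : a * s ^ n = s' ^ n * a := SemiconjBy.pow_right (show SemiconjBy a s s' from hs) n
    simp only [aeval_monomial]
    rw [← mul_assoc, ← Algebra.commutes c a, mul_assoc, hn, mul_assoc]

namespace GWA

/-- The degree one quantum GWA. -/
abbrev One (q : k) (h : k[X]) : Type _ := GWA k 1 (fun _ => q) (fun _ => h)

variable {q : k} {h : k[X]}

theorem x_mul_t : (x 0 : One q h) * t = q • (t * x 0) := by
  simpa [x, t] using RingQuot.mkAlgHom_rel k
    (GWARel.xt (k := k) (m := 1) (q := fun _ => q) (h := fun _ => h) 0)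

theorem y_mul_t : (y 0 : One q h) * t = q⁻¹ • (t * y 0) := by
  simpa [y, t] using RingQuot.mkAlgHom_rel k
    (GWARel.yt (k := k) (m := 1) (q := fun _ => q) (h := fun _ => h) 0)

theorem x_mul_y : (x 0 : One q h) * y 0 = aeval t h := by
  have := RingQuot.mkAlgHom_rel k (GWARel.xy (k := k) (m := 1) (q := fun _ => q) (h := fun _ => h) 0)
  rw [map_mul, ← aeval_algHom_apply] at this
  exact this

theorem y_mul_x : (y 0 : One q h) * x 0 = aeval (q⁻¹ • t) h := by
  have := RingQuot.mkAlgHom_rel k (GWARel.yx (k := k) (m := 1) (q := fun _ => q) (h := fun _ => h) 0)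
  rw [map_mul, ← aeval_algHom_apply, map_smul] at this
  exact this

/-- The induction principle for elements generated by `x`, `y`, `t`. -/
theorem induction_left {S : Submodule k (One q h)} (one : 1 ∈ S) (hx : ∀ w ∈ S, x 0 * w ∈ S)
    (hy : ∀ w ∈ S, y 0 * w ∈ S) (ht : ∀ w ∈ S, t * w ∈ S) (w : One q h) : w ∈ S := by
  obtain ⟨w, rfl⟩ := RingQuot.mkAlgHom_surjective k _ w
  suffices H : ∀ u ∈ S, RingQuot.mkAlgHom k (GWARel k 1 (fun _ => q) (fun _ => h)) w * u ∈ S by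
    simpa using H 1 one
  induction w using FreeAlgebra.induction with
  | grade0 c =>
    intro u hu
    rw [AlgHom.commutes, ← Algebra.smul_def]
    exact S.smul_mem c hu
  | grade1 g =>
    intro u hu
    cases g with
    | x i => rw [Subsingleton.elim i 0]; exact hx u hu
    | y i => rw [Subsingleton.elim i 0]; exact hy u hu
    | t => exact ht u hu
  | mul a b ha hb => intro u hu; rw [map_mul, mul_assoc]; exact ha _ (hb _ hu)
  | add a b ha hb => intro u hu; rw [map_add, add_mul]; exact S.add_mem (ha _ hu) (hb _ hu)

/-- The standard homogeneous element of degree `d`: a power of `x` or of `y`. -/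
noncomputable def pow (d : ℤ) : One q h := x 0 ^ d.toNat * y 0 ^ (-d).toNat

theorem pow_natCast (n : ℕ) : (pow (n : ℤ) : One q h) = x 0 ^ n := by simp [pow]

theorem pow_neg_natCast (n : ℕ) : (pow (-(n : ℤ)) : One q h) = y 0 ^ n := by simp [pow]

theorem pow_zero' : (pow 0 : One q h) = 1 := by simp [pow]

theorem pow_one' : (pow 1 : One q h) = x 0 := by simp [pow]

theorem pow_neg_one : (pow (-1) : One q h) = y 0 := by simp [pow]

theorem pow_mul_pow {d s : ℤ} (hds : (0 ≤ d ∧ 0 ≤ s) ∨ (d ≤ 0 ∧ s ≤ 0)) :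
    (pow d : One q h) * pow s = pow (d + s) := by
  rcases hds with ⟨hd, hs⟩ | ⟨hd, hs⟩
  · lift d to ℕ using hd
    lift s to ℕ using hs
    rw [← Nat.cast_add, pow_natCast, pow_natCast, pow_natCast, pow_add]
  · obtain ⟨n, rfl⟩ : ∃ n : ℕ, d = -n := ⟨(-d).toNat, by omega⟩
    obtain ⟨l, rfl⟩ : ∃ n : ℕ, s = -n := ⟨(-s).toNat, by omega⟩
    rw [show -(n : ℤ) + -(l : ℤ) = -((n + l : ℕ) : ℤ) by push_cast; ring, pow_neg_natCast,
      pow_neg_natCast, pow_neg_natCast, pow_add]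

theorem aeval_smul_t (c : k) (p : k[X]) :
    aeval (c • (t : One q h)) p = aeval (t : One q h) (p.comp (C c * X)) := by
  rw [aeval_comp]; simp [Algebra.smul_def]

theorem exists_x_mul_pow (d : ℤ) : ∃ p : k[X], (x 0 : One q h) * pow d = aeval t p * pow (d + 1) := by
  rcases le_or_gt 0 d with hd | hd
  · refine ⟨1, ?_⟩
    rw [map_one, one_mul, ← pow_one', pow_mul_pow (by omega), add_comm]
  · refine ⟨h, ?_⟩
    rw [show d = -1 + (d + 1) by ring, ← pow_mul_pow (by omega), ← mul_assoc, pow_neg_one, x_mul_y]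
    congr 2; ring

theorem exists_y_mul_pow (d : ℤ) : ∃ p : k[X], (y 0 : One q h) * pow d = aeval t p * pow (d - 1) := by
  rcases le_or_gt d 0 with hd | hd
  · refine ⟨1, ?_⟩
    rw [map_one, one_mul, ← pow_neg_one, pow_mul_pow (by omega)]
    congr 1; ring
  · refine ⟨h.comp (C q⁻¹ * X), ?_⟩
    rw [show d = 1 + (d - 1) by ring, ← pow_mul_pow (by omega), ← mul_assoc, pow_one', y_mul_x,
      aeval_smul_t]
    congr 2; ring

theorem aeval_t_mul_pow_mem (p : k[X]) (d : ℤ) : aeval (t : One q h) p * pow d ∈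
    Submodule.span k (Set.range fun ed : ℕ × ℤ => (t : One q h) ^ ed.1 * pow ed.2) := by
  induction p using Polynomial.induction_on' with
  | add p p' hp hp' => rw [map_add, add_mul]; exact add_mem hp hp'
  | monomial n c =>
    rw [aeval_monomial, mul_assoc, ← Algebra.smul_def]
    exact Submodule.smul_mem _ _ (Submodule.subset_span ⟨(n, d), rfl⟩)

/-- The elements `tᵉ xⁿ` and `tᵉ yⁿ` span. -/
theorem mem_span (w : One q h) :
    w ∈ Submodule.span k (Set.range fun ed : ℕ × ℤ => (t : One q h) ^ ed.1 * pow ed.2) := by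
  set S := Submodule.span k (Set.range fun ed : ℕ × ℤ => (t : One q h) ^ ed.1 * pow ed.2) with hS
  have key : ∀ a : One q h, (∀ e d, a * (t ^ e * pow d) ∈ S) → ∀ w ∈ S, a * w ∈ S := by
    intro a ha w hw
    induction hw using Submodule.span_induction with
    | mem w hw => obtain ⟨⟨e, d⟩, rfl⟩ := hw; exact ha e d
    | zero => simp
    | add u v _ _ hu hv => rw [mul_add]; exact add_mem hu hv
    | smul c u _ hu => rw [mul_smul_comm]; exact S.smul_mem _ hu
  refine induction_left ?_ (key _ fun e d => ?_) (key _ fun e d => ?_) (key _ fun e d => ?_) w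
  · exact Submodule.subset_span ⟨(0, 0), by simp [pow_zero']⟩
  · obtain ⟨p, hp⟩ := exists_x_mul_pow (q := q) (h := h) d
    have h1 := mul_aeval_of_mul_eq (a := (x 0 : One q h)) (s := t) (s' := q • t)
      (by rw [x_mul_t, smul_mul_assoc]) (X ^ e : k[X])
    rw [aeval_smul_t, map_pow, aeval_X] at h1
    rw [← mul_assoc, h1, mul_assoc, hp, ← mul_assoc, ← map_mul]
    exact aeval_t_mul_pow_mem _ _
  · obtain ⟨p, hp⟩ := exists_y_mul_pow (q := q) (h := h) d
    have h1 := mul_aeval_of_mul_eq (a := (y 0 : One q h)) (s := t) (s' := q⁻¹ • t)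
      (by rw [y_mul_t, smul_mul_assoc]) (X ^ e : k[X])
    rw [aeval_smul_t, map_pow, aeval_X] at h1
    rw [← mul_assoc, h1, mul_assoc, hp, ← mul_assoc, ← map_mul]
    exact aeval_t_mul_pow_mem _ _
  · rw [← mul_assoc, ← pow_succ']
    exact Submodule.subset_span ⟨(e + 1, d), rfl⟩

theorem x_mul_y_pow_of_pow_eq_one {n : ℕ} (hq : q ^ n = 1) :
    (x 0 : One q h) * y 0 ^ n = y 0 ^ n * x 0 := by
  cases n with
  | zero => simp
  | succ n =>
  have hy : ∀ c : k, (y 0 : One q h) * (c • t) = (q⁻¹ * c) • t * y 0 := fun c => by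
    rw [mul_smul_comm, y_mul_t, smul_smul, smul_mul_assoc, mul_comm c]
  have hyn : ∀ l : ℕ, (y 0 : One q h) ^ l * (q⁻¹ • t) = ((q⁻¹) ^ (l + 1) • t) * y 0 ^ l := fun l => by
    induction l with
    | zero => simp
    | succ l ih => rw [pow_succ' (y 0 : One q h), mul_assoc, ih, ← mul_assoc, hy, mul_assoc, ← pow_succ']
  rw [pow_succ (y 0 : One q h), mul_assoc (y 0 ^ n), y_mul_x, mul_aeval_of_mul_eq (hyn n), ← pow_succ,
    pow_succ', ← mul_assoc, x_mul_y, inv_pow, hq, inv_one, one_smul]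

theorem x_mul_pow_of_pow_eq_one {d : ℤ} (hq : q ^ d.natAbs = 1) :
    (x 0 : One q h) * pow d = pow d * x 0 := by
  rcases le_total 0 d with hd | hd
  · lift d to ℕ using hd
    rw [pow_natCast, ← pow_succ, ← pow_succ']
  · obtain ⟨n, rfl⟩ : ∃ n : ℕ, d = -n := ⟨(-d).toNat, by omega⟩
    rw [pow_neg_natCast]
    exact x_mul_y_pow_of_pow_eq_one (by simpa using hq)

end GWA

/-! ### The embedding of a degree one quantum GWA into a quantum torus -/

/-- The bicharacter of the quantum torus of rank two. -/
noncomputable def torusBichar {q : k} (hq : q ≠ 0) : Bicharacter k (ℤ × ℤ) where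
  toFun a b := q ^ (a.2 * b.1)
  add_left a b c := by rw [← zpow_add₀ hq, Prod.snd_add]; ring_nf
  add_right a b c := by rw [← zpow_add₀ hq, Prod.fst_add]; ring_nf
  ne_zero a b := zpow_ne_zero _ hq

theorem torusBichar_apply {q : k} (hq : q ≠ 0) (a b : ℤ × ℤ) :
    (torusBichar hq).toFun a b = q ^ (a.2 * b.1) := rfl

namespace GWA

open TwistedAlgebra

variable {q : k} (hq : q ≠ 0) (h : k[X])

/-- The image of `y` in the quantum torus. -/
noncomputable def torusY : TwistedAlgebra (torusBichar hq) :=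
  aeval (q⁻¹ • basis (torusBichar hq) (1, 0)) h * basis (torusBichar hq) (0, -1)

theorem torus_x_mul_t : basis (torusBichar hq) (0, 1) * basis (torusBichar hq) (1, 0) =
    q • (basis (torusBichar hq) (1, 0) * basis (torusBichar hq) (0, 1)) := by
  rw [basis_mul_basis, basis_mul_basis, smul_smul]
  simp [torusBichar_apply]

theorem torus_x_inv_mul_t : basis (torusBichar hq) (0, -1) * basis (torusBichar hq) (1, 0) =
    q⁻¹ • (basis (torusBichar hq) (1, 0) * basis (torusBichar hq) (0, -1)) := by
  rw [basis_mul_basis, basis_mul_basis, smul_smul]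
  simp [torusBichar_apply]

theorem torus_x_mul_x_inv :
    basis (torusBichar hq) (0, 1) * basis (torusBichar hq) (0, -1) = 1 := by
  rw [basis_mul_basis, ← basis_zero]; simp [torusBichar_apply, Prod.zero_eq_mk]

theorem torus_x_inv_mul_x :
    basis (torusBichar hq) (0, -1) * basis (torusBichar hq) (0, 1) = 1 := by
  rw [basis_mul_basis, ← basis_zero]; simp [torusBichar_apply, Prod.zero_eq_mk]

/-- The images of the generators in the quantum torus. -/
noncomputable def torusGen : GWAGen 1 → TwistedAlgebra (torusBichar hq)
  | .x _ => basis _ (0, 1)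
  | .y _ => torusY hq h
  | .t => basis _ (1, 0)

/-- The embedding of the quantum GWA into the quantum torus. -/
noncomputable def toTorus : One q h →ₐ[k] TwistedAlgebra (torusBichar hq) :=
  RingQuot.liftAlgHom k ⟨FreeAlgebra.lift k (torusGen hq h), by
    intro u v huv
    induction huv with
    | xt i =>
      simp only [map_mul, map_smul, FreeAlgebra.lift_ι_apply, torusGen]
      exact torus_x_mul_t hq
    | yt i =>
      simp only [map_mul, map_smul, FreeAlgebra.lift_ι_apply, torusGen, torusY]
      have hc : Commute (aeval (q⁻¹ • basis (torusBichar hq) (1, 0)) h)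
          (basis (torusBichar hq) (1, 0)) := by
        have := mul_aeval_of_mul_eq (a := basis (torusBichar hq) (1, 0))
          (s := q⁻¹ • basis (torusBichar hq) (1, 0)) (s' := q⁻¹ • basis (torusBichar hq) (1, 0))
          (by rw [smul_mul_assoc, mul_smul_comm]) h
        exact this.symm
      rw [mul_assoc, torus_x_inv_mul_t, mul_smul_comm, ← mul_assoc, hc.eq, mul_assoc]
    | xy i =>
      simp only [map_mul, FreeAlgebra.lift_ι_apply, torusGen, torusY, ← aeval_algHom_apply]
      rw [← mul_assoc, mul_aeval_of_mul_eq (s' := basis (torusBichar hq) (1, 0)), mul_assoc,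
        torus_x_mul_x_inv, mul_one]
      rw [mul_smul_comm, torus_x_mul_t, smul_smul, inv_mul_cancel₀ hq, one_smul]
    | yx i =>
      simp only [map_mul, FreeAlgebra.lift_ι_apply, torusGen, torusY, ← aeval_algHom_apply,
        map_smul]
      rw [mul_assoc, torus_x_inv_mul_x, mul_one]
    | xx i j hij => exact absurd (Subsingleton.elim i j) hij
    | yy i j hij => exact absurd (Subsingleton.elim i j) hij
    | xyc i j hij => exact absurd (Subsingleton.elim i j) hij⟩

theorem toTorus_t : toTorus hq h t = basis _ (1, 0) := by
  simp [toTorus, t, torusGen]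

theorem toTorus_x : toTorus hq h (x 0) = basis _ (0, 1) := by
  simp [toTorus, x, torusGen]

theorem toTorus_y : toTorus hq h (y 0) = torusY hq h := by
  simp [toTorus, y, torusGen]

theorem torus_t_pow (e : ℕ) :
    basis (torusBichar hq) (1, 0) ^ e = basis (torusBichar hq) ((e : ℤ), 0) := by
  induction e with
  | zero => simp only [_root_.pow_zero, Nat.cast_zero]; rfl
  | succ e ih => rw [pow_succ, ih, basis_mul_basis]; simp [torusBichar_apply]

theorem toTorus_aeval_t (p : k[X]) : aeval (basis (torusBichar hq) (1, 0)) p ∈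
    supported (torusBichar hq) {g | 0 ≤ g.1 ∧ g.2 = 0} := by
  induction p using Polynomial.induction_on' with
  | add p p' hp hp' => rw [map_add]; exact add_mem hp hp'
  | monomial n c =>
    rw [aeval_monomial, ← Algebra.smul_def, torus_t_pow]
    exact Submodule.smul_mem _ _ (basis_mem_supported (by simp))

theorem repr_aeval_t (p : k[X]) (e : ℕ) :
    (basis _).repr (aeval (basis (torusBichar hq) (1, 0)) p) ((e : ℤ), 0) = p.coeff e := by
  induction p using Polynomial.induction_on' with
  | add p p' hp hp' => simp [hp, hp']
  | monomial n c =>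
    rw [aeval_monomial, ← Algebra.smul_def, torus_t_pow, coeff_monomial]
    simp [Finsupp.single_apply]

variable {h}

theorem aeval_torus_ne_zero (hh : h ≠ 0) (c : k) (hc : c ≠ 0) :
    (basis _).repr (aeval (c • basis (torusBichar hq) (1, 0)) h) ((h.natDegree : ℤ), 0) ≠ 0 := by
  have : c • basis (torusBichar hq) (1, 0) = aeval (basis (torusBichar hq) (1, 0)) (C c * X) := by
    simp [Algebra.smul_def]
  rw [this, ← aeval_comp, repr_aeval_t]
  have h1 : (C c * X : k[X]).natDegree = 1 := natDegree_C_mul_X c hc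
  have h2 : (h.comp (C c * X)).natDegree = h.natDegree := by rw [natDegree_comp, h1, mul_one]
  rw [← h2, coeff_natDegree, leadingCoeff_comp (by simp [h1])]
  simp [hh, hc]

theorem torusY_mem : torusY hq h ∈ supported (torusBichar hq) {g | g.2 = -1} := by
  have : q⁻¹ • basis (torusBichar hq) (1, 0)
      = aeval (basis (torusBichar hq) (1, 0)) (C q⁻¹ * X) := by
    simp [Algebra.smul_def]
  rw [torusY, this, ← aeval_comp]
  refine mul_mem_supported ?_ (toTorus_aeval_t hq _)
    (basis_mem_supported (S := {((0 : ℤ), (-1 : ℤ))}) rfl)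
  rintro a ha b rfl
  simp [ha.2]

theorem exists_repr_torusY (hh : h ≠ 0) :
    ∃ g : ℤ × ℤ, (basis _).repr (torusY hq h) g ≠ 0 ∧ (h.natDegree : ℤ) ≤ g.1 := by
  obtain ⟨g, hg, hle⟩ := exists_repr_mul_ne_zero (AddMonoidHom.fst ℤ ℤ)
    (aeval_torus_ne_zero hq hh q⁻¹ (inv_ne_zero hq))
    (v := basis (torusBichar hq) (0, -1)) (b := (0, -1)) (by simp)
  exact ⟨g, hg, by simpa using hle⟩

theorem torus_x_pow (n : ℕ) :
    basis (torusBichar hq) (0, 1) ^ n = basis (torusBichar hq) (0, (n : ℤ)) := by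
  induction n with
  | zero => simp only [_root_.pow_zero, Nat.cast_zero]; rfl
  | succ e ih => rw [pow_succ, ih, basis_mul_basis]; simp [torusBichar_apply]

theorem toTorus_pow_mem (d : ℤ) :
    toTorus hq h (pow d) ∈ supported (torusBichar hq) {g | g.2 = d} := by
  rcases le_total 0 d with hd | hd
  · lift d to ℕ using hd
    rw [pow_natCast, map_pow, toTorus_x, torus_x_pow]
    exact basis_mem_supported rfl
  · obtain ⟨n, rfl⟩ : ∃ n : ℕ, d = -n := ⟨(-d).toNat, by omega⟩
    rw [pow_neg_natCast, map_pow, toTorus_y]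
    induction n with
    | zero =>
      rw [_root_.pow_zero, ← basis_zero]
      exact basis_mem_supported rfl
    | succ n ih =>
      rw [pow_succ]
      refine mul_mem_supported ?_ (ih (by omega)) (torusY_mem hq)
      intro a ha b hb
      simp only [Set.mem_ofPred_eq, Prod.snd_add] at *
      rw [ha, hb]; push_cast; ring

theorem exists_repr_toTorus_pow (hh : h ≠ 0) (d : ℤ) :
    ∃ g : ℤ × ℤ, (basis _).repr (toTorus hq h (pow d)) g ≠ 0 ∧
      (h.natDegree : ℤ) * max 0 (-d) ≤ g.1 := by
  rcases le_total 0 d with hd | hd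
  · lift d to ℕ using hd
    rw [pow_natCast, map_pow, toTorus_x, torus_x_pow]
    exact ⟨(0, d), by simp, by simp⟩
  · obtain ⟨n, rfl⟩ : ∃ n : ℕ, d = -n := ⟨(-d).toNat, by omega⟩
    rw [pow_neg_natCast, map_pow, toTorus_y]
    induction n with
    | zero =>
      rw [_root_.pow_zero, ← basis_zero]
      exact ⟨0, by simp, by simp⟩
    | succ n ih =>
      obtain ⟨g, hg, hle⟩ := ih (by omega)
      obtain ⟨g', hg', hle'⟩ := exists_repr_torusY hq hh
      obtain ⟨g₂, h₂, hle₂⟩ := exists_repr_mul_ne_zero (AddMonoidHom.fst ℤ ℤ) hg hg'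
      refine ⟨g₂, by rwa [pow_succ], ?_⟩
      rw [neg_neg, max_eq_right (by positivity)] at hle ⊢
      simp only [AddMonoidHom.coe_fst] at hle₂
      push_cast
      linarith

theorem zpow_eq_one_of_repr_toTorus_pow {d : ℤ} (hd : q ^ d.natAbs = 1) {g : ℤ × ℤ}
    (hg : (basis _).repr (toTorus hq h (pow d)) g ≠ 0) : q ^ g.1 = 1 ∧ q ^ g.2 = 1 := by
  constructor
  · have h1 := congrArg (toTorus hq h) (x_mul_pow_of_pow_eq_one (q := q) (h := h) hd)
    rw [map_mul, map_mul, toTorus_x] at h1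
    simpa [torusBichar_apply] using (bichar_comm_of_commute h1 hg).symm
  · have hd' : q ^ d = 1 := by
      rcases Int.natAbs_eq d with h1 | h1 <;> rw [h1] <;>
        simp only [zpow_neg, zpow_natCast, hd, inv_one]
    have := mem_supported.1 (toTorus_pow_mem hq d) g hg
    rw [Set.mem_ofPred_eq] at this
    rw [this, hd']

end GWA

/-! ### The embedding of the tensor product into a quantum torus -/

section TensorTorus

open TwistedAlgebra

variable {r : ℕ} {Q : Fin r → k} (hQ : ∀ i, Q i ≠ 0)

/-- The bicharacter of the tensor product of rank two quantum tori. -/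
noncomputable def piBichar : Bicharacter k (Fin r → ℤ × ℤ) where
  toFun a b := ∏ i, Q i ^ ((a i).2 * (b i).1)
  add_left a b c := by
    rw [← Finset.prod_mul_distrib]
    exact Finset.prod_congr rfl fun i _ => (torusBichar (hQ i)).add_left _ _ _
  add_right a b c := by
    rw [← Finset.prod_mul_distrib]
    exact Finset.prod_congr rfl fun i _ => (torusBichar (hQ i)).add_right _ _ _
  ne_zero a b := Finset.prod_ne_zero_iff.2 fun i _ => zpow_ne_zero _ (hQ i)

theorem piBichar_apply (a b : Fin r → ℤ × ℤ) :
    (piBichar hQ).toFun a b = ∏ i, Q i ^ ((a i).2 * (b i).1) := rfl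

open Classical in
/-- The outer product of elements of quantum tori. -/
noncomputable def outer : MultilinearMap k (fun i => TwistedAlgebra (torusBichar (hQ i)))
    (TwistedAlgebra (piBichar hQ)) :=
  ((PiTensorProduct.ofFinsuppEquiv' (R := k) (κ := fun _ : Fin r => ℤ × ℤ)).trans
    (basis (piBichar hQ)).repr.symm).toLinearMap.compMultilinearMap
    ((PiTensorProduct.tprod k).compLinearMap fun i => (basis (torusBichar (hQ i))).repr.toLinearMap)

theorem repr_outer (u : ∀ i, TwistedAlgebra (torusBichar (hQ i))) (g : Fin r → ℤ × ℤ) :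
    (basis _).repr (outer hQ u) g = ∏ i, (basis _).repr (u i) (g i) := by
  simp [outer]

theorem outer_basis (g : Fin r → ℤ × ℤ) : outer hQ (fun i => basis _ (g i)) = basis _ g := by
  simp [outer]

theorem outer_mul (u v : ∀ i, TwistedAlgebra (torusBichar (hQ i))) :
    outer hQ (u * v) = outer hQ u * outer hQ v := by
  have h1 : (outer hQ).compLinearMap (fun i => LinearMap.mulRight k (v i)) =
      (LinearMap.mulRight k (outer hQ v)).compMultilinearMap (outer hQ) := by
    refine Module.Basis.ext_multilinear (fun i => basis _) fun g => ?_
    have h2 : (outer hQ).compLinearMap (fun i => LinearMap.mulLeft k (basis _ (g i))) =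
        (LinearMap.mulLeft k (outer hQ fun i => basis _ (g i))).compMultilinearMap (outer hQ) := by
      refine Module.Basis.ext_multilinear (fun i => basis _) fun g' => ?_
      simp only [MultilinearMap.compLinearMap_apply, LinearMap.mulLeft_apply,
        LinearMap.compMultilinearMap_apply, basis_mul_basis]
      rw [MultilinearMap.map_smul_univ, outer_basis, outer_basis, outer_basis, basis_mul_basis]
      rfl
    have h3 := congrArg (fun f => f v) h2
    simpa using h3
  exact congrArg (fun f => f u) h1

variable (H : Fin r → k[X])

/-- The tensor product of degree one quantum GWAs. -/
abbrev TensorGWA (Q : Fin r → k) (H : Fin r → k[X]) : Type _ := ⨂[k] j, GWA.One (Q j) (H j)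

/-- The embedding of the tensor product into the quantum torus. -/
noncomputable def toPiTorus : TensorGWA Q H →ₐ[k] TwistedAlgebra (piBichar hQ) :=
  PiTensorProduct.liftAlgHom
    ((outer hQ).compLinearMap fun i => (GWA.toTorus (hQ i) (H i)).toLinearMap)
    (by
      simp only [MultilinearMap.compLinearMap_apply, AlgHom.toLinearMap_apply, Pi.one_apply,
        map_one]
      exact outer_basis hQ 0)
    (fun u v => by
      simp only [MultilinearMap.compLinearMap_apply, AlgHom.toLinearMap_apply, Pi.mul_apply,
        map_mul]
      exact outer_mul hQ _ _)

theorem toPiTorus_tprod (w : ∀ i, GWA.One (Q i) (H i)) :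
    toPiTorus hQ H (PiTensorProduct.tprod k w) = outer hQ fun i => GWA.toTorus (hQ i) (H i) (w i) :=
  PiTensorProduct.lift.tprod w

/-- A monomial in the elements `tᵢ`. -/
noncomputable def tPow (Q : Fin r → k) (H : Fin r → k[X]) (e : Fin r → ℕ) : TensorGWA Q H :=
  PiTensorProduct.tprod k fun i => GWA.t ^ e i

/-- A standard monomial in the elements `xᵢ` and `yᵢ`. -/
noncomputable def xPow (Q : Fin r → k) (H : Fin r → k[X]) (d : Fin r → ℤ) : TensorGWA Q H :=
  PiTensorProduct.tprod k fun i => GWA.pow (d i)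

/-- The exponent of the monomial `tᵉ` in the quantum torus. -/
def tExp (e : Fin r → ℤ) : Fin r → ℤ × ℤ := fun i => (e i, 0)

/-- The grading of the quantum torus by powers of the `xᵢ`. -/
def xDeg (r : ℕ) : (Fin r → ℤ × ℤ) →+ (Fin r → ℤ) where
  toFun g i := (g i).2
  map_zero' := rfl
  map_add' _ _ := rfl

/-- The grading of the quantum torus by powers of `tₗ`. -/
def tDeg {r : ℕ} (l : Fin r) : (Fin r → ℤ × ℤ) →+ ℤ where
  toFun g := (g l).1
  map_zero' := rfl
  map_add' _ _ := rfl

theorem toPiTorus_tPow (e : Fin r → ℕ) :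
    toPiTorus hQ H (tPow Q H e) = basis _ (tExp fun i => (e i : ℤ)) := by
  rw [tPow, toPiTorus_tprod]
  simp only [map_pow, GWA.toTorus_t, GWA.torus_t_pow]
  exact outer_basis hQ (tExp fun i => (e i : ℤ))

/-- The image of `xPow` in the quantum torus. -/
noncomputable def torusX (d : Fin r → ℤ) : TwistedAlgebra (piBichar hQ) :=
  toPiTorus hQ H (xPow Q H d)

theorem repr_torusX (d : Fin r → ℤ) (g : Fin r → ℤ × ℤ) :
    (basis _).repr (torusX hQ H d) g =
      ∏ i, (basis _).repr (GWA.toTorus (hQ i) (H i) (GWA.pow (d i))) (g i) := by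
  rw [torusX, xPow, toPiTorus_tprod, repr_outer]

theorem torusX_mem (d : Fin r → ℤ) :
    torusX hQ H d ∈ supported (piBichar hQ) (xDeg r ⁻¹' {d}) := by
  rw [mem_supported]
  intro g hg
  rw [repr_torusX, Finset.prod_ne_zero_iff] at hg
  ext i
  exact mem_supported.1 (GWA.toTorus_pow_mem (hQ i) (d i)) _ (hg i (Finset.mem_univ i))

theorem exists_repr_torusX {H : Fin r → k[X]} (hH : ∀ i, H i ≠ 0) (d : Fin r → ℤ) :
    ∃ g, (basis _).repr (torusX hQ H d) g ≠ 0 ∧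
      ∀ i, ((H i).natDegree : ℤ) * max 0 (-d i) ≤ tDeg i g := by
  choose g hg hle using fun i => GWA.exists_repr_toTorus_pow (hQ i) (hH i) (d i)
  refine ⟨g, ?_, hle⟩
  rw [repr_torusX, Finset.prod_ne_zero_iff]
  exact fun i _ => hg i

theorem torusX_ne_zero {H : Fin r → k[X]} (hH : ∀ i, H i ≠ 0) (d : Fin r → ℤ) :
    torusX hQ H d ≠ 0 := by
  obtain ⟨g, hg, -⟩ := exists_repr_torusX hQ hH d
  rintro h0
  simp [h0] at hg

theorem xPow_mul_xPow {d s : Fin r → ℤ} (hds : ∀ i, (0 ≤ d i ∧ 0 ≤ s i) ∨ (d i ≤ 0 ∧ s i ≤ 0)) :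
    xPow Q H d * xPow Q H s = xPow Q H (d + s) := by
  rw [xPow, xPow, PiTensorProduct.tprod_mul_tprod, xPow]
  congr 1
  ext i
  exact GWA.pow_mul_pow (hds i)

theorem torusX_mul_torusX {d s : Fin r → ℤ}
    (hds : ∀ i, (0 ≤ d i ∧ 0 ≤ s i) ∨ (d i ≤ 0 ∧ s i ≤ 0)) :
    torusX hQ H d * torusX hQ H s = torusX hQ H (d + s) := by
  rw [torusX, torusX, ← map_mul, xPow_mul_xPow H hds, torusX]

theorem mem_radical_piBichar {g : Fin r → ℤ × ℤ} :
    g ∈ radical (piBichar hQ) ↔ ∀ i, Q i ^ (g i).1 = 1 ∧ Q i ^ (g i).2 = 1 := by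
  constructor
  · intro hg i
    have h1 := hg (Pi.single i (0, 1))
    have h2 := hg (Pi.single i (1, 0))
    simp only [piBichar_apply] at h1 h2
    rw [Finset.prod_eq_single_of_mem i (Finset.mem_univ i) fun b _ hb => by
      simp [Pi.single_eq_of_ne hb], Finset.prod_eq_single_of_mem i (Finset.mem_univ i) fun b _ hb =>
      by simp [Pi.single_eq_of_ne hb]] at h1 h2
    simp only [Pi.single_eq_same, mul_zero, zpow_zero, mul_one, one_mul, zero_mul] at h1 h2
    exact ⟨h1.symm, h2⟩
  · intro hg b
    simp only [piBichar_apply]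
    refine Finset.prod_congr rfl fun i _ => ?_
    rw [zpow_mul, (hg i).2, mul_comm, zpow_mul, (hg i).1, one_zpow, one_zpow]

theorem torusX_mem_radical {d : Fin r → ℤ} (hd : ∀ i, Q i ^ (d i).natAbs = 1) :
    torusX hQ H d ∈ supported (piBichar hQ) (radical (piBichar hQ)) := by
  rw [mem_supported]
  intro g hg
  rw [repr_torusX, Finset.prod_ne_zero_iff] at hg
  rw [mem_radical_piBichar]
  exact fun i => GWA.zpow_eq_one_of_repr_toTorus_pow (hQ i) (hd i) (hg i (Finset.mem_univ i))

/-- The monomials `tᵉ xᵈ` span the tensor product. -/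
theorem tensorGWA_mem_span (u : TensorGWA Q H) : u ∈ Submodule.span k
    (Set.range fun ed : (Fin r → ℕ) × (Fin r → ℤ) => tPow Q H ed.1 * xPow Q H ed.2) := by
  classical
  set S := Submodule.span k
    (Set.range fun ed : (Fin r → ℕ) × (Fin r → ℤ) => tPow Q H ed.1 * xPow Q H ed.2) with hS
  have key : ∀ s : Finset (Fin r), ∀ w : ∀ i, GWA.One (Q i) (H i),
      (∀ i ∉ s, ∃ (e : ℕ) (d : ℤ), w i = GWA.t ^ e * GWA.pow d) →
      PiTensorProduct.tprod k w ∈ S := by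
    intro s
    induction s using Finset.induction with
    | empty =>
      intro w hw
      choose e d hed using fun i => hw i (Finset.notMem_empty i)
      refine Submodule.subset_span ⟨(e, d), ?_⟩
      simp only [tPow, xPow]
      rw [PiTensorProduct.tprod_mul_tprod]
      congr 1
      ext i
      exact (hed i).symm
    | insert a s ha ih =>
      intro w hw
      suffices hz : ∀ z ∈ Submodule.span k
          (Set.range fun ed : ℕ × ℤ => (GWA.t : GWA.One (Q a) (H a)) ^ ed.1 * GWA.pow ed.2),
          PiTensorProduct.tprod k (Function.update w a z) ∈ S by
        simpa using hz (w a) (GWA.mem_span _)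
      intro z hz
      induction hz using Submodule.span_induction with
      | mem z hz =>
        obtain ⟨⟨e, d⟩, rfl⟩ := hz
        refine ih _ fun i hi => ?_
        by_cases hia : i = a
        · subst hia
          exact ⟨e, d, by simp⟩
        · rw [Function.update_of_ne hia]
          exact hw i (by simp [hia, hi])
      | zero => rw [MultilinearMap.map_update_zero]; exact zero_mem _
      | add u v _ _ hu hv => rw [MultilinearMap.map_update_add]; exact add_mem hu hv
      | smul c u _ hu => rw [MultilinearMap.map_update_smul]; exact S.smul_mem c hu
  induction u using PiTensorProduct.induction_on with
  | smul_tprod c w => exact S.smul_mem c (key Finset.univ w (by simp))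
  | add u v hu hv => exact add_mem hu hv

end TensorTorus

/-! ### The image of the tensor product in the quantum torus -/

section Image

open TwistedAlgebra

variable {r : ℕ} {Q : Fin r → k} (hQ : ∀ i, Q i ≠ 0)

/-- The polynomials in the `tᵢ` inside the quantum torus. -/
noncomputable def tPoly : Submodule k (TwistedAlgebra (piBichar hQ)) :=
  supported (piBichar hQ) {g | ∀ i, 0 ≤ (g i).1 ∧ (g i).2 = 0}

theorem basis_tExp_mul (e e' : Fin r → ℤ) :
    basis (piBichar hQ) (tExp e) * basis (piBichar hQ) (tExp e') = basis _ (tExp (e + e')) := by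
  rw [basis_mul_basis, piBichar_apply]
  simp only [tExp, zero_mul, zpow_zero, Finset.prod_const_one, one_smul]
  rfl

theorem basis_tExp_mem_tPoly (e : Fin r → ℕ) :
    basis (piBichar hQ) (tExp fun i => (e i : ℤ)) ∈ tPoly hQ :=
  basis_mem_supported fun i => by simp [tExp]

theorem mul_mem_tPoly {f g : TwistedAlgebra (piBichar hQ)} (hf : f ∈ tPoly hQ) (hg : g ∈ tPoly hQ) :
    f * g ∈ tPoly hQ := by
  refine mul_mem_supported (fun a ha b hb i => ?_) hf hg
  simp only [Pi.add_apply, Prod.fst_add, Prod.snd_add]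
  have := ha i
  have := hb i
  omega

theorem tPoly_le_supported : tPoly hQ ≤ supported (piBichar hQ) (xDeg r ⁻¹' {0}) :=
  supported_mono fun g hg => by
    ext i
    exact (hg i).2

@[elab_as_elim]
theorem tPoly_induction {p : (u : TwistedAlgebra (piBichar hQ)) → u ∈ tPoly hQ → Prop}
    (basis : ∀ e : Fin r → ℕ, p (basis _ (tExp fun i => (e i : ℤ))) (basis_tExp_mem_tPoly hQ e))
    (zero : p 0 (zero_mem _))
    (add : ∀ u v hu hv, p u hu → p v hv → p (u + v) (add_mem hu hv))
    (smul : ∀ (c : k) u hu, p u hu → p (c • u) (Submodule.smul_mem _ c hu))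
    {u : TwistedAlgebra (piBichar hQ)} (hu : u ∈ tPoly hQ) : p u hu := by
  refine supported_induction (p := p) (fun g hg => ?_) zero add smul hu
  obtain ⟨e, rfl⟩ : ∃ e : Fin r → ℕ, g = tExp fun i => (e i : ℤ) := by
    refine ⟨fun i => (g i).1.toNat, ?_⟩
    ext i
    · have := hg i; simp only [tExp]; omega
    · have := hg i; simp only [tExp]; omega
  exact basis e

theorem commute_of_mem_tPoly {f g : TwistedAlgebra (piBichar hQ)} (hf : f ∈ tPoly hQ)
    (hg : g ∈ tPoly hQ) : f * g = g * f := by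
  induction hf using tPoly_induction with
  | zero => simp
  | add u u' _ _ hu hu' => rw [add_mul, mul_add, hu, hu']
  | smul c u _ hu => rw [smul_mul_assoc, mul_smul_comm, hu]
  | basis e =>
  induction hg using tPoly_induction with
  | zero => simp
  | add u u' _ _ hu hu' => rw [add_mul, mul_add, hu, hu']
  | smul c u _ hu => rw [smul_mul_assoc, mul_smul_comm, hu]
  | basis e' => rw [basis_tExp_mul, basis_tExp_mul, add_comm]

variable (H : Fin r → k[X])

theorem mul_torusX_mem_supported {f : TwistedAlgebra (piBichar hQ)} (hf : f ∈ tPoly hQ)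
    (d : Fin r → ℤ) : f * torusX hQ H d ∈ supported (piBichar hQ) (xDeg r ⁻¹' {d}) := by
  have := mul_mem_supported_preimage (xDeg r) (tPoly_le_supported hQ hf) (torusX_mem hQ H d)
  rwa [zero_add] at this

open Classical in
/-- The coefficient of `xᵈ` in a combination of standard monomials. -/
noncomputable def xCoeff (d : Fin r → ℤ) :
    ((Fin r → ℕ) × (Fin r → ℤ) →₀ k) →ₗ[k] TwistedAlgebra (piBichar hQ) :=
  Finsupp.linearCombination k fun ed : (Fin r → ℕ) × (Fin r → ℤ) =>
    if ed.2 = d then basis (piBichar hQ) (tExp fun i => (ed.1 i : ℤ)) else 0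

theorem xCoeff_mem (d : Fin r → ℤ) (l : (Fin r → ℕ) × (Fin r → ℤ) →₀ k) :
    xCoeff hQ d l ∈ tPoly hQ := by
  classical
  rw [xCoeff, Finsupp.linearCombination_apply]
  refine sum_mem fun ed _ => Submodule.smul_mem _ _ ?_
  split_ifs
  · exact basis_tExp_mem_tPoly hQ _
  · exact zero_mem _

theorem proj_toPiTorus_linearCombination (d : Fin r → ℤ)
    (l : (Fin r → ℕ) × (Fin r → ℤ) →₀ k) :
    proj (piBichar hQ) (xDeg r ⁻¹' {d}) (toPiTorus hQ H (Finsupp.linearCombination k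
      (fun ed : (Fin r → ℕ) × (Fin r → ℤ) => tPow Q H ed.1 * xPow Q H ed.2) l)) =
    xCoeff hQ d l * torusX hQ H d := by
  classical
  induction l using Finsupp.induction_linear with
  | zero => simp
  | add l l' hl hl' => simp only [map_add, hl, hl', add_mul]
  | single ed c =>
    rw [xCoeff, Finsupp.linearCombination_single, Finsupp.linearCombination_single, map_smul,
      map_smul, smul_mul_assoc, map_mul, toPiTorus_tPow]
    congr 1
    have h1 := mul_torusX_mem_supported hQ H (basis_tExp_mem_tPoly hQ ed.1) ed.2
    split_ifs with hd
    · rw [hd] at h1 ⊢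
      exact proj_eq_self h1
    · rw [zero_mul]
      exact proj_eq_zero (disjoint_preimage _ (Ne.symm hd)) h1

theorem repr_xCoeff (d : Fin r → ℤ) (e : Fin r → ℕ) (l : (Fin r → ℕ) × (Fin r → ℤ) →₀ k) :
    (basis _).repr (xCoeff hQ d l) (tExp fun i => (e i : ℤ)) = l (e, d) := by
  classical
  induction l using Finsupp.induction_linear with
  | zero => simp
  | add l l' hl hl' => simp only [map_add, hl, hl', Finsupp.add_apply]
  | single ed c =>
    obtain ⟨e', d'⟩ := ed
    rw [xCoeff, Finsupp.linearCombination_single, map_smul]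
    by_cases hd : d' = d
    · by_cases he : e' = e
      · simp [hd, he]
      · have : (tExp fun i => (e' i : ℤ)) ≠ tExp fun i => (e i : ℤ) := fun h1 => he <| by
          ext i
          have := congrArg Prod.fst (congrFun h1 i)
          simpa [tExp] using this
        simp [hd, he, this]
    · simp [hd]

variable {H}

theorem toPiTorus_injective (hH : ∀ i, H i ≠ 0) : Function.Injective (toPiTorus hQ H) := by
  rw [injective_iff_map_eq_zero]
  intro u hu
  obtain ⟨l, rfl⟩ := (Finsupp.mem_span_range_iff_exists_finsupp).1 (tensorGWA_mem_span H u)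
  suffices l = 0 by simp [this]
  ext ⟨e, d⟩
  have h1 := proj_toPiTorus_linearCombination hQ H d l
  rw [Finsupp.linearCombination_apply, hu, map_zero] at h1
  have h2 := (mul_eq_zero.1 h1.symm).resolve_right (torusX_ne_zero hQ hH d)
  rw [← repr_xCoeff hQ, h2]
  simp

theorem proj_toPiTorus (u : TensorGWA Q H) (d : Fin r → ℤ) :
    ∃ f ∈ tPoly hQ, proj (piBichar hQ) (xDeg r ⁻¹' {d}) (toPiTorus hQ H u) =
      f * torusX hQ H d := by
  obtain ⟨l, rfl⟩ := (Finsupp.mem_span_range_iff_exists_finsupp).1 (tensorGWA_mem_span H u)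
  exact ⟨xCoeff hQ d l, xCoeff_mem hQ d l, proj_toPiTorus_linearCombination hQ H d l⟩

theorem mem_range_of_mem_tPoly {f : TwistedAlgebra (piBichar hQ)} (hf : f ∈ tPoly hQ) :
    f ∈ (toPiTorus hQ H).range := by
  induction hf using tPoly_induction with
  | zero => exact zero_mem _
  | add u u' _ _ hu hu' => exact add_mem hu hu'
  | smul c u _ hu => exact Subalgebra.smul_mem _ hu c
  | basis e => exact ⟨tPow Q H e, toPiTorus_tPow hQ H e⟩

theorem mem_range_toPiTorus {u : TwistedAlgebra (piBichar hQ)} :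
    u ∈ (toPiTorus hQ H).range ↔ ∀ d, ∃ f ∈ tPoly hQ,
      proj (piBichar hQ) (xDeg r ⁻¹' {d}) u = f * torusX hQ H d := by
  constructor
  · rintro ⟨u, rfl⟩
    exact proj_toPiTorus hQ u
  · intro hu
    rw [← sum_proj_eq (xDeg r) (u := u) (A := degrees (xDeg r) u)
      fun g hg => (mem_degrees _).2 ⟨g, hg, rfl⟩]
    refine sum_mem fun d _ => ?_
    obtain ⟨f, hf, h1⟩ := hu d
    rw [h1]
    exact mul_mem (mem_range_of_mem_tPoly hQ hf) ⟨_, rfl⟩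

end Image

namespace TwistedAlgebra

variable {G : Type*} [AddCommGroup G] {χ : Bicharacter k G}

theorem proj_mul_right {S : Type*} [AddCommGroup S] (σ : G →+ S) {b : S} {v : TwistedAlgebra χ}
    (hv : v ∈ supported χ (σ ⁻¹' {b})) (a : S) (u : TwistedAlgebra χ) :
    proj χ (σ ⁻¹' {a + b}) (u * v) = proj χ (σ ⁻¹' {a}) u * v := by
  classical
  induction u using induction_basis with
  | zero => simp
  | add u u' hu hu' => simp only [add_mul, map_add, hu, hu']
  | smul c u hu => simp only [smul_mul_assoc, map_smul, hu]
  | basis g =>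
    have h1 := mul_mem_supported_preimage σ (basis_mem_supported (χ := χ)
      (show g ∈ σ ⁻¹' {σ g} from rfl)) hv
    rw [proj_basis]
    split_ifs with hg
    · rw [show σ g = a from hg] at h1
      exact proj_eq_self h1
    · rw [zero_mul]
      exact proj_eq_zero (disjoint_preimage σ fun h2 => hg (add_right_cancel h2).symm) h1

theorem proj_mul_left {S : Type*} [AddCommGroup S] (σ : G →+ S) {a : S} {u : TwistedAlgebra χ}
    (hu : u ∈ supported χ (σ ⁻¹' {a})) (b : S) (v : TwistedAlgebra χ) :
    proj χ (σ ⁻¹' {a + b}) (u * v) = u * proj χ (σ ⁻¹' {b}) v := by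
  classical
  induction v using induction_basis with
  | zero => simp
  | add u u' hu hu' => simp only [mul_add, map_add, hu, hu']
  | smul c u hu => simp only [mul_smul_comm, map_smul, hu]
  | basis g =>
    have h1 := mul_mem_supported_preimage σ hu (basis_mem_supported (χ := χ)
      (show g ∈ σ ⁻¹' {σ g} from rfl))
    rw [proj_basis]
    split_ifs with hg
    · rw [show σ g = b from hg] at h1
      exact proj_eq_self h1
    · rw [mul_zero]
      exact proj_eq_zero (disjoint_preimage σ fun h2 => hg (add_left_cancel h2).symm) h1

theorem proj_proj_comm (S T : Set G) (u : TwistedAlgebra χ) :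
    proj χ S (proj χ T u) = proj χ T (proj χ S u) := by
  classical
  refine (basis χ).repr.injective (Finsupp.ext fun g => ?_)
  simp only [repr_proj]
  split_ifs <;> rfl

theorem proj_mem_of_mem {S T : Set G} {u : TwistedAlgebra χ} (hu : u ∈ supported χ T) :
    proj χ S u ∈ supported χ T := by
  classical
  rw [mem_supported] at hu ⊢
  intro g hg
  rw [repr_proj] at hg
  split_ifs at hg
  · exact hu g hg
  · exact absurd rfl hg

end TwistedAlgebra

/-! ### Commutators up to the center -/

section Conductor

variable {R R' : Type*} [Ring R] [Algebra k R] [Ring R'] [Algebra k R']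

variable (k R) in
/-- The span of the commutators. -/
def commSpan : Submodule k R := Submodule.span k {w | ∃ u v : R, w = u * v - v * u}

variable (k) in
/-- Elements which become sums of commutators after multiplication by a nonzero central element. -/
def IsCommSat (a : R) : Prop := ∃ z ∈ Subalgebra.center k R, z ≠ 0 ∧ z * a ∈ commSpan k R

variable (k) in
/-- The fraction `b / z` pairs `R` into `R` modulo commutators. -/
def IsDualPair (b z : R) : Prop :=
  z ∈ Subalgebra.center k R ∧ z ≠ 0 ∧ ∀ c, ∃ a, IsCommSat k (b * c - z * a)

variable (k) in
/-- Elements multiplying the dual of `R` into `R`. -/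
def IsConductor (a : R) : Prop := ∀ b z, IsDualPair k b z → ∃ c, a * b = z * c

theorem commSpan_map (φ : R ≃ₐ[k] R') {a : R} (ha : a ∈ commSpan k R) : φ a ∈ commSpan k R' := by
  induction ha using Submodule.span_induction with
  | mem a ha =>
    obtain ⟨u, v, rfl⟩ := ha
    exact Submodule.subset_span ⟨φ u, φ v, by simp⟩
  | zero => simp
  | add u v _ _ hu hv => rw [map_add]; exact add_mem hu hv
  | smul c u _ hu => rw [map_smul]; exact Submodule.smul_mem _ c hu

theorem center_map {A B : Type*} [Semiring A] [Algebra k A] [Semiring B] [Algebra k B]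
    (φ : A ≃ₐ[k] B) {z : A} (hz : z ∈ Subalgebra.center k A) : φ z ∈ Subalgebra.center k B := by
  rw [Subalgebra.mem_center_iff] at hz ⊢
  intro b
  simpa using congrArg φ (hz (φ.symm b))

theorem IsCommSat.map (φ : R ≃ₐ[k] R') {a : R} (ha : IsCommSat k a) : IsCommSat k (φ a) := by
  obtain ⟨z, hz, hz0, h1⟩ := ha
  exact ⟨φ z, center_map φ hz, by simpa using hz0, by simpa using commSpan_map φ h1⟩

theorem IsDualPair.map (φ : R ≃ₐ[k] R') {b z : R} (hb : IsDualPair k b z) :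
    IsDualPair k (φ b) (φ z) := by
  refine ⟨center_map φ hb.1, by simpa using hb.2.1, fun c => ?_⟩
  obtain ⟨a, ha⟩ := hb.2.2 (φ.symm c)
  exact ⟨φ a, by simpa using ha.map φ⟩

theorem IsConductor.map (φ : R ≃ₐ[k] R') {a : R} (ha : IsConductor k a) : IsConductor k (φ a) := by
  intro b z hb
  obtain ⟨c, hc⟩ := ha _ _ (hb.map φ.symm)
  exact ⟨φ c, by simpa using congrArg φ hc⟩

theorem mul_mem_commSpan {z a : R} (hz : z ∈ Subalgebra.center k R) (ha : a ∈ commSpan k R) :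
    z * a ∈ commSpan k R := by
  rw [Subalgebra.mem_center_iff] at hz
  induction ha using Submodule.span_induction with
  | mem a ha =>
    obtain ⟨u, v, rfl⟩ := ha
    refine Submodule.subset_span ⟨z * u, v, ?_⟩
    rw [mul_sub, mul_assoc, ← mul_assoc v, hz, mul_assoc]
  | zero => simp
  | add u v _ _ hu hv => rw [mul_add]; exact add_mem hu hv
  | smul c u _ hu => rw [mul_smul_comm]; exact Submodule.smul_mem _ c hu

end Conductor

/-! ### Commutators and the center in the tensor product -/

namespace TwistedAlgebra

theorem exists_basis_mul_basis_eq_smul {G : Type*} [AddCommGroup G] {χ : Bicharacter k G}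
    {ζ g s : G} (hζ : ζ ∈ radical χ) (hsg : χ.toFun s g ≠ χ.toFun g s) :
    ∃ c : k, basis χ ζ * basis χ g =
      c • (basis χ s * basis χ (ζ + g - s) - basis χ (ζ + g - s) * basis χ s) := by
  have hc : χ.toFun s (ζ + g - s) - χ.toFun (ζ + g - s) s ≠ 0 := by
    intro h0
    rw [sub_eq_zero] at h0
    have h1 : χ.toFun s (ζ + g - s + s) = χ.toFun (ζ + g - s + s) s := by
      rw [χ.add_left, χ.add_right, h0]
    rw [sub_add_cancel, χ.add_left, χ.add_right, hζ s] at h1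
    exact hsg (mul_left_cancel₀ (χ.ne_zero _ _) h1)
  refine ⟨χ.toFun ζ g * (χ.toFun s (ζ + g - s) - χ.toFun (ζ + g - s) s)⁻¹, ?_⟩
  rw [basis_mul_basis, basis_mul_basis, basis_mul_basis, add_sub_cancel, sub_add_cancel,
    ← sub_smul, smul_smul, mul_assoc, inv_mul_cancel₀ hc, mul_one]

end TwistedAlgebra

section Trace

open TwistedAlgebra

variable {r : ℕ} {Q : Fin r → k} (hQ : ∀ i, Q i ≠ 0) {H : Fin r → k[X]}

/-- The projection onto the span of the central monomials. -/
noncomputable def trace : TwistedAlgebra (piBichar hQ) →ₗ[k] TwistedAlgebra (piBichar hQ) :=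
  proj (piBichar hQ) (radical (piBichar hQ))

theorem mem_radical_of_single {g : Fin r → ℤ × ℤ}
    (hx : ∀ i, (piBichar hQ).toFun (Pi.single i (0, 1)) g =
      (piBichar hQ).toFun g (Pi.single i (0, 1)))
    (ht : ∀ i, (piBichar hQ).toFun (Pi.single i (1, 0)) g =
      (piBichar hQ).toFun g (Pi.single i (1, 0))) : g ∈ radical (piBichar hQ) := by
  rw [mem_radical_piBichar]
  intro i
  have h1 := hx i
  have h2 := ht i
  simp only [piBichar_apply] at h1 h2
  rw [Finset.prod_eq_single_of_mem i (Finset.mem_univ i) fun b _ hb => by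
    simp [Pi.single_eq_of_ne hb], Finset.prod_eq_single_of_mem i (Finset.mem_univ i) fun b _ hb =>
    by simp [Pi.single_eq_of_ne hb]] at h1 h2
  simp only [Pi.single_eq_same, mul_zero, zpow_zero, mul_one, one_mul, zero_mul] at h1 h2
  exact ⟨h1, h2.symm⟩

theorem torusX_natCast (n : Fin r → ℕ) :
    torusX hQ H (fun i => (n i : ℤ)) = basis _ fun i => ((0 : ℤ), (n i : ℤ)) := by
  rw [torusX, xPow, toPiTorus_tprod]
  simp only [GWA.pow_natCast, map_pow, GWA.toTorus_x, GWA.torus_x_pow]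
  exact outer_basis hQ fun i => ((0 : ℤ), (n i : ℤ))

variable (H) in
theorem basis_mem_range {g : Fin r → ℤ × ℤ} (hg : ∀ i, 0 ≤ (g i).1 ∧ 0 ≤ (g i).2) :
    basis (piBichar hQ) g ∈ (toPiTorus hQ H).range := by
  obtain ⟨e, he⟩ : ∃ e : Fin r → ℕ, ∀ i, (e i : ℤ) = (g i).1 :=
    ⟨fun i => (g i).1.toNat, fun i => Int.toNat_of_nonneg (hg i).1⟩
  obtain ⟨n, hn⟩ : ∃ e : Fin r → ℕ, ∀ i, (e i : ℤ) = (g i).2 :=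
    ⟨fun i => (g i).2.toNat, fun i => Int.toNat_of_nonneg (hg i).2⟩
  refine ⟨tPow Q H e * xPow Q H fun i => (n i : ℤ), ?_⟩
  change toPiTorus hQ H _ = _
  rw [map_mul, toPiTorus_tPow]
  refine (congrArg _ (torusX_natCast hQ n)).trans ?_
  rw [basis_mul_basis, piBichar_apply]
  simp only [tExp, zero_mul, zpow_zero, Finset.prod_const_one, one_smul]
  congr 1
  ext i <;> simp [tExp, he, hn]

theorem mem_center_iff_toPiTorus (hH : ∀ i, H i ≠ 0) {z : TensorGWA Q H} :
    z ∈ Subalgebra.center k (TensorGWA Q H) ↔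
      toPiTorus hQ H z ∈ supported (piBichar hQ) (radical (piBichar hQ)) := by
  rw [Subalgebra.mem_center_iff]
  constructor
  · intro hz
    have key : ∀ s : Fin r → ℤ × ℤ, (∀ i, 0 ≤ (s i).1 ∧ 0 ≤ (s i).2) →
        basis _ s * toPiTorus hQ H z = toPiTorus hQ H z * basis _ s := by
      intro s hs
      obtain ⟨b, hb⟩ := basis_mem_range hQ H hs
      rw [← hb]
      change toPiTorus hQ H b * _ = _ * toPiTorus hQ H b
      rw [← map_mul, ← map_mul, hz]
    rw [mem_supported]
    intro g hg
    refine mem_radical_of_single hQ (fun i => ?_) (fun i => ?_)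
    · refine (bichar_comm_of_commute (key _ fun j => ?_) hg).symm
      by_cases hj : j = i
      · subst hj; simp
      · simp [Pi.single_eq_of_ne hj]
    · refine (bichar_comm_of_commute (key _ fun j => ?_) hg).symm
      by_cases hj : j = i
      · subst hj; simp
      · simp [Pi.single_eq_of_ne hj]
  · intro hz b
    apply toPiTorus_injective hQ hH
    rw [map_mul, map_mul, commute_of_mem_supported_radical hz]

theorem trace_commSpan {u : TensorGWA Q H} (hu : u ∈ commSpan k (TensorGWA Q H)) :
    trace hQ (toPiTorus hQ H u) = 0 := by
  induction hu using Submodule.span_induction with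
  | mem a ha =>
    obtain ⟨u, v, rfl⟩ := ha
    rw [map_sub, map_mul, map_mul, map_sub, trace, proj_radical_mul_comm, sub_self]
  | zero => simp
  | add u v _ _ hu hv => rw [map_add, map_add, hu, hv, add_zero]
  | smul c u _ hu => rw [map_smul, map_smul, hu, smul_zero]

theorem exists_center_mul_basis_mem (hH : ∀ i, H i ≠ 0) (hfin : ∀ i, IsOfFinOrder (Q i))
    {g : Fin r → ℤ × ℤ} (hg : g ∉ radical (piBichar hQ)) :
    ∃ z ∈ Subalgebra.center k (TensorGWA Q H), z ≠ 0 ∧ ∃ u ∈ commSpan k (TensorGWA Q H),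
      toPiTorus hQ H z * basis _ g = toPiTorus hQ H u := by
  obtain ⟨s, hs, hsg⟩ : ∃ s : Fin r → ℤ × ℤ,
      (∀ j, 0 ≤ (s j).1 ∧ 0 ≤ (s j).2 ∧ (s j).1 ≤ 1 ∧ (s j).2 ≤ 1) ∧
      (piBichar hQ).toFun s g ≠ (piBichar hQ).toFun g s := by
    by_contra! hcon
    refine hg (mem_radical_of_single hQ (fun i => hcon _ fun j => ?_) (fun i => hcon _ fun j => ?_))
    all_goals
      by_cases hj : j = i
      · subst hj; simp
      · simp [Pi.single_eq_of_ne hj]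
  have hn : ∀ i, 0 < orderOf (Q i) := fun i => (hfin i).orderOf_pos
  set L : Fin r → ℤ := fun i => |(g i).1| + |(g i).2| + 1 with hL
  set ζ : Fin r → ℤ × ℤ := fun i => (orderOf (Q i) * L i, orderOf (Q i) * L i) with hζ
  have hLn : ∀ i, L i ≤ orderOf (Q i) * L i := fun i => by
    have h1 : (1 : ℤ) ≤ orderOf (Q i) := by exact_mod_cast hn i
    have h2 : 0 ≤ L i := by positivity
    nlinarith
  have hζr : ζ ∈ radical (piBichar hQ) := by
    rw [mem_radical_piBichar]
    intro i
    simp only [hζ, zpow_mul, zpow_natCast, pow_orderOf_eq_one, one_zpow, and_self]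
  obtain ⟨z, hz⟩ := basis_mem_range hQ H (g := ζ) fun i => by
    have := hLn i
    have : 0 ≤ L i := by positivity
    simp only [hζ]; omega
  obtain ⟨a, ha⟩ := basis_mem_range hQ H (g := s) fun i => ⟨(hs i).1, (hs i).2.1⟩
  obtain ⟨b, hb⟩ := basis_mem_range hQ H (g := ζ + g - s) fun i => by
    have h1 := hLn i
    have h2 := hs i
    have h3 := neg_abs_le (g i).1
    have h4 := neg_abs_le (g i).2
    have h5 := abs_nonneg (g i).1
    have h6 := abs_nonneg (g i).2
    simp only [hL] at h1
    simp only [hζ, hL, Pi.sub_apply, Pi.add_apply, Prod.fst_sub, Prod.fst_add, Prod.snd_sub,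
      Prod.snd_add]
    omega
  change toPiTorus hQ H z = _ at hz
  change toPiTorus hQ H a = _ at ha
  change toPiTorus hQ H b = _ at hb
  obtain ⟨c, hc⟩ := exists_basis_mul_basis_eq_smul hζr hsg
  refine ⟨z, (mem_center_iff_toPiTorus hQ hH).2 (hz ▸ basis_mem_supported hζr), ?_,
    c • (a * b - b * a), Submodule.smul_mem _ _ (Submodule.subset_span ⟨a, b, rfl⟩), ?_⟩
  · rintro rfl
    rw [map_zero] at hz
    exact (basis (piBichar hQ)).ne_zero ζ hz.symm
  · rw [map_smul, map_sub, map_mul, map_mul, hz, ha, hb, hc]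

theorem isCommSat_iff (hH : ∀ i, H i ≠ 0) (hfin : ∀ i, IsOfFinOrder (Q i)) {a : TensorGWA Q H} :
    IsCommSat k a ↔ trace hQ (toPiTorus hQ H a) = 0 := by
  constructor
  · rintro ⟨z, hz, hz0, h1⟩
    have h2 := trace_commSpan hQ h1
    rw [map_mul, trace, proj_radical_mul ((mem_center_iff_toPiTorus hQ hH).1 hz)] at h2
    refine (mul_eq_zero.1 h2).resolve_left ?_
    exact (map_ne_zero_iff _ (toPiTorus_injective hQ hH)).2 hz0
  · intro ha
    have key : ∀ u ∈ supported (piBichar hQ) (radical (piBichar hQ))ᶜ,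
        ∃ z ∈ Subalgebra.center k (TensorGWA Q H), z ≠ 0 ∧ ∃ v ∈ commSpan k (TensorGWA Q H),
          toPiTorus hQ H z * u = toPiTorus hQ H v := by
      intro u hu
      have hinj := toPiTorus_injective hQ hH
      induction hu using supported_induction with
      | basis g hg => exact exists_center_mul_basis_mem hQ hH hfin hg
      | zero =>
        refine ⟨1, one_mem _, ?_, 0, zero_mem _, by simp⟩
        rw [← map_ne_zero_iff _ hinj, map_one]
        exact one_ne_zero
      | smul c u _ hu =>
        obtain ⟨z, hz, hz0, v, hv, h1⟩ := hu
        exact ⟨z, hz, hz0, c • v, Submodule.smul_mem _ _ hv, by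
          rw [mul_smul_comm, h1, map_smul]⟩
      | add u u' _ _ hu hu' =>
        obtain ⟨z, hz, hz0, v, hv, h1⟩ := hu
        obtain ⟨z', hz', hz0', v', hv', h1'⟩ := hu'
        refine ⟨z' * z, mul_mem hz' hz, ?_, z' * v + z * v',
          add_mem (mul_mem_commSpan hz' hv) (mul_mem_commSpan hz hv'), ?_⟩
        · rw [← map_ne_zero_iff _ hinj] at hz0 hz0' ⊢
          rw [map_mul]
          exact mul_ne_zero hz0' hz0
        · rw [mul_add, map_mul, mul_assoc, h1, map_add, map_mul, map_mul, ← h1', ← mul_assoc,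
            commute_of_mem_supported_radical
              ((mem_center_iff_toPiTorus hQ hH).1 hz') (toPiTorus hQ H z),
            mul_assoc]
    have hmem : toPiTorus hQ H a ∈ supported (piBichar hQ) (radical (piBichar hQ))ᶜ := by
      classical
      rw [mem_supported]
      intro g hg hgr
      have := repr_proj (χ := piBichar hQ) (radical (piBichar hQ)) (toPiTorus hQ H a) g
      rw [if_pos hgr] at this
      rw [trace] at ha
      rw [ha, map_zero] at this
      exact hg this.symm
    obtain ⟨z, hz, hz0, v, hv, h1⟩ := key _ hmem
    refine ⟨z, hz, hz0, ?_⟩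
    rw [← map_mul] at h1
    rwa [toPiTorus_injective hQ hH h1]

end Trace

/-! ### The conductor -/

namespace TwistedAlgebra

variable {G : Type*} [AddCommGroup G] {χ : Bicharacter k G}

theorem sum_proj_radical_mul_basis (s : Finset G)
    (hs : ∀ a, ∃ g ∈ s, a + g ∈ radical χ ∧ ∀ g' ∈ s, a + g' ∈ radical χ → g' = g)
    (u : TwistedAlgebra χ) :
    ∑ g ∈ s, (χ.toFun g (-g))⁻¹ • (proj χ (radical χ) (u * basis χ g) * basis χ (-g)) = u := by
  classical
  induction u using induction_basis with
  | zero => simp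
  | add u u' hu hu' =>
    simp only [add_mul, map_add, smul_add, Finset.sum_add_distrib, hu, hu']
  | smul c u hu =>
    simp only [smul_mul_assoc, map_smul, smul_comm _ c, ← Finset.smul_sum, hu]
  | basis a =>
    obtain ⟨g, hg, hag, huniq⟩ := hs a
    rw [Finset.sum_eq_single_of_mem g hg]
    · have h1 : proj χ (radical χ) (basis χ a * basis χ g) = basis χ a * basis χ g := by
        rw [basis_mul_basis, map_smul, proj_basis, if_pos hag]
      rw [h1, mul_assoc, basis_mul_basis g, add_neg_cancel, basis_zero, mul_smul_comm, mul_one,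
        smul_smul, inv_mul_cancel₀ (χ.ne_zero _ _), one_smul]
    · intro g' hg' hne
      rw [basis_mul_basis, map_smul, proj_basis, if_neg fun h1 => hne (huniq g' hg' h1)]
      simp

end TwistedAlgebra

section Trace

open TwistedAlgebra

variable {r : ℕ} {Q : Fin r → k} (hQ : ∀ i, Q i ≠ 0) {H : Fin r → k[X]}

theorem orderOf_dvd_iff_zpow_eq_one_of_ne_zero {a : k} (ha : a ≠ 0) {n : ℤ} :
    (orderOf a : ℤ) ∣ n ↔ a ^ n = 1 := by
  rw [← Units.val_mk0 ha, orderOf_units, orderOf_dvd_iff_zpow_eq_one, Units.ext_iff]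
  simp

theorem eq_neg_emod {n a g : ℤ} (h0 : 0 ≤ g) (hg : g < n) (h : n ∣ a + g) : g = -a % n := by
  rw [← Int.emod_eq_of_lt h0 hg]
  exact Int.emod_eq_emod_iff_emod_sub_eq_zero.2
    (Int.emod_eq_zero_of_dvd (by rwa [sub_neg_eq_add, add_comm]))

open Classical in
theorem trace_mul_torusX {f : TwistedAlgebra (piBichar hQ)} (hf : f ∈ tPoly hQ) (d : Fin r → ℤ) :
    trace hQ (f * torusX hQ H d) =
      (if ∀ i, Q i ^ (d i).natAbs = 1 then trace hQ f else 0) * torusX hQ H d := by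
  split_ifs with hd
  · have h1 := torusX_mem_radical hQ H hd
    rw [trace, ← commute_of_mem_supported_radical h1, proj_radical_mul h1,
      commute_of_mem_supported_radical h1]
  · rw [zero_mul]
    refine proj_eq_zero ?_ (mul_torusX_mem_supported hQ H hf d)
    rw [Set.disjoint_left]
    rintro g hg hgd
    refine hd fun i => ?_
    have h1 := ((mem_radical_piBichar hQ).1 hg i).2
    rw [show (g i).2 = d i from congrFun hgd i] at h1
    rcases Int.natAbs_eq (d i) with h2 | h2 <;> rw [h2] at h1
    · exact_mod_cast h1
    · rw [zpow_neg, inv_eq_one] at h1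
      exact_mod_cast h1

theorem trace_mem_tPoly {f : TwistedAlgebra (piBichar hQ)} (hf : f ∈ tPoly hQ) :
    trace hQ f ∈ tPoly hQ := proj_mem_of_mem hf

theorem trace_mem_range {u : TwistedAlgebra (piBichar hQ)} (hu : u ∈ (toPiTorus hQ H).range) :
    trace hQ u ∈ (toPiTorus hQ H).range := by
  classical
  rw [mem_range_toPiTorus] at hu ⊢
  intro d
  obtain ⟨f, hf, h1⟩ := hu d
  refine ⟨_, ?_, by rw [trace, proj_proj_comm, h1]; exact trace_mul_torusX hQ hf d⟩
  split_ifs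
  · exact trace_mem_tPoly hQ hf
  · exact zero_mem _

theorem exists_box (hfin : ∀ i, IsOfFinOrder (Q i)) : ∃ s : Finset (Fin r → ℤ × ℤ),
    (∀ g ∈ s, ∀ i, 0 ≤ (g i).1 ∧ 0 ≤ (g i).2) ∧
    ∀ a, ∃ g ∈ s, a + g ∈ radical (piBichar hQ) ∧
      ∀ g' ∈ s, a + g' ∈ radical (piBichar hQ) → g' = g := by
  have hn : ∀ i, (0 : ℤ) < orderOf (Q i) := fun i => by exact_mod_cast (hfin i).orderOf_pos
  refine ⟨Fintype.piFinset fun i =>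
    Finset.Ico (0 : ℤ) (orderOf (Q i)) ×ˢ Finset.Ico (0 : ℤ) (orderOf (Q i)), ?_, fun a => ?_⟩
  · intro g hg i
    have := Fintype.mem_piFinset.1 hg i
    simp only [Finset.mem_product, Finset.mem_Ico] at this
    exact ⟨this.1.1, this.2.1⟩
  · refine ⟨fun i => ((-(a i).1) % orderOf (Q i), (-(a i).2) % orderOf (Q i)), ?_, ?_, ?_⟩
    · simp only [Fintype.mem_piFinset, Finset.mem_product, Finset.mem_Ico]
      exact fun i => ⟨⟨Int.emod_nonneg _ (hn i).ne', Int.emod_lt_of_pos _ (hn i)⟩,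
        ⟨Int.emod_nonneg _ (hn i).ne', Int.emod_lt_of_pos _ (hn i)⟩⟩
    · rw [mem_radical_piBichar]
      intro i
      constructor
      · rw [← orderOf_dvd_iff_zpow_eq_one_of_ne_zero (hQ i), Int.dvd_iff_emod_eq_zero]
        simp
      · rw [← orderOf_dvd_iff_zpow_eq_one_of_ne_zero (hQ i), Int.dvd_iff_emod_eq_zero]
        simp
    · intro g' hg' h1
      rw [mem_radical_piBichar] at h1
      ext i
      all_goals
        have h2 := Fintype.mem_piFinset.1 hg' i
        simp only [Finset.mem_product, Finset.mem_Ico] at h2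
      · exact eq_neg_emod h2.1.1 h2.1.2 ((orderOf_dvd_iff_zpow_eq_one_of_ne_zero (hQ i)).2 (h1 i).1)
      · exact eq_neg_emod h2.2.1 h2.2.2 ((orderOf_dvd_iff_zpow_eq_one_of_ne_zero (hQ i)).2 (h1 i).2)

theorem exists_of_isDualPair (hH : ∀ i, H i ≠ 0) (hfin : ∀ i, IsOfFinOrder (Q i))
    {b z : TensorGWA Q H} (hbz : IsDualPair k b z) :
    ∃ w, toPiTorus hQ H b = toPiTorus hQ H z * w ∧
      ∀ c ∈ (toPiTorus hQ H).range, trace hQ (w * c) ∈ (toPiTorus hQ H).range := by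
  obtain ⟨hz, hz0, h1⟩ := hbz
  have hzr := (mem_center_iff_toPiTorus hQ hH).1 hz
  have hz0' : toPiTorus hQ H z ≠ 0 := (map_ne_zero_iff _ (toPiTorus_injective hQ hH)).2 hz0
  have key : ∀ c ∈ (toPiTorus hQ H).range, ∃ v ∈ (toPiTorus hQ H).range,
      trace hQ (toPiTorus hQ H b * c) = toPiTorus hQ H z * v := by
    rintro _ ⟨c, rfl⟩
    obtain ⟨a, ha⟩ := h1 c
    rw [isCommSat_iff hQ hH hfin, map_sub (toPiTorus hQ H), map_mul (toPiTorus hQ H),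
      map_mul (toPiTorus hQ H), map_sub (trace hQ), sub_eq_zero] at ha
    refine ⟨trace hQ (toPiTorus hQ H a), trace_mem_range hQ ⟨a, rfl⟩, ?_⟩
    exact ha.trans (proj_radical_mul hzr _)
  obtain ⟨s, hs0, hs⟩ := exists_box hQ hfin
  choose! v hv hv' using key
  set w := ∑ g ∈ s, ((piBichar hQ).toFun g (-g))⁻¹ • (v (basis _ g) * basis _ (-g)) with hw
  have hbw : toPiTorus hQ H b = toPiTorus hQ H z * w := by
    rw [hw, Finset.mul_sum]
    refine (sum_proj_radical_mul_basis s hs _).symm.trans (Finset.sum_congr rfl fun g hg => ?_)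
    rw [mul_smul_comm, ← mul_assoc, ← hv' _ (basis_mem_range hQ H (hs0 g hg))]
    rfl
  refine ⟨w, hbw, fun c hc => ?_⟩
  have h2 := hv' c hc
  rw [hbw, mul_assoc, trace, proj_radical_mul hzr] at h2
  rw [trace, mul_left_cancel₀ hz0' h2]
  exact hv c hc

theorem sum_tBox (hfin : ∀ i, IsOfFinOrder (Q i)) {u : TwistedAlgebra (piBichar hQ)}
    (hu : u ∈ supported (piBichar hQ) {g | ∀ i, Q i ^ (g i).2 = 1}) :
    ∑ e ∈ Fintype.piFinset fun i => Finset.range (orderOf (Q i)),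
      basis _ (tExp fun i => ((orderOf (Q i) - 1 - e i : ℕ) : ℤ)) *
        trace hQ (basis _ (tExp fun i => (e i : ℤ)) * u) =
      basis _ (tExp fun i => ((orderOf (Q i) - 1 : ℕ) : ℤ)) * u := by
  classical
  have hn : ∀ i, (0 : ℤ) < orderOf (Q i) := fun i => by exact_mod_cast (hfin i).orderOf_pos
  induction hu using supported_induction with
  | zero => simp
  | add u u' _ _ hu hu' => simp only [mul_add, map_add, Finset.sum_add_distrib, hu, hu']
  | smul c u _ hu => simp only [mul_smul_comm, map_smul, ← Finset.smul_sum, hu]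
  | basis a ha =>
    have h0 : ∀ i, 0 ≤ (-(a i).1) % (orderOf (Q i) : ℤ) := fun i => Int.emod_nonneg _ (hn i).ne'
    have h1 : ∀ i, (-(a i).1) % (orderOf (Q i) : ℤ) < orderOf (Q i) := fun i =>
      Int.emod_lt_of_pos _ (hn i)
    have hrad : ∀ e : Fin r → ℕ, tExp (fun i => (e i : ℤ)) + a ∈ radical (piBichar hQ) ↔
        ∀ i, (orderOf (Q i) : ℤ) ∣ e i + (a i).1 := by
      intro e
      rw [mem_radical_piBichar]
      refine forall_congr' fun i => ?_
      simp only [tExp, Pi.add_apply, Prod.fst_add, Prod.snd_add, zero_add,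
        ← orderOf_dvd_iff_zpow_eq_one_of_ne_zero (hQ i)]
      exact and_iff_left ((orderOf_dvd_iff_zpow_eq_one_of_ne_zero (hQ i)).2 (ha i))
    rw [Finset.sum_eq_single_of_mem fun i => ((-(a i).1) % (orderOf (Q i) : ℤ)).toNat]
    · rw [trace, basis_mul_basis (tExp _) a, map_smul, proj_basis, if_pos, ← basis_mul_basis,
        ← mul_assoc, basis_tExp_mul]
      · congr 3
        ext i
        have := h0 i
        have := h1 i
        simp only [Pi.add_apply]
        omega
      · rw [hrad]
        intro i
        rw [Int.toNat_of_nonneg (h0 i), Int.dvd_iff_emod_eq_zero]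
        simp
    · rw [Fintype.mem_piFinset]
      intro i
      rw [Finset.mem_range]
      have := h0 i
      have := h1 i
      omega
    · intro e he hne
      rw [trace, basis_mul_basis (tExp _) a, map_smul, proj_basis, if_neg]
      · simp
      · rw [hrad]
        refine fun h2 => hne (funext fun i => ?_)
        have h3 := Finset.mem_range.1 (Fintype.mem_piFinset.1 he i)
        have h4 := eq_neg_emod (n := orderOf (Q i)) (by positivity) (by exact_mod_cast h3)
          (show _ ∣ (a i).1 + (e i : ℤ) by rw [add_comm]; exact h2 i)
        omega

theorem basis_mul_mem_range_of_trace (hH : ∀ i, H i ≠ 0) (hfin : ∀ i, IsOfFinOrder (Q i))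
    {w : TwistedAlgebra (piBichar hQ)}
    (hw : ∀ c ∈ (toPiTorus hQ H).range, trace hQ (w * c) ∈ (toPiTorus hQ H).range) :
    basis _ (tExp fun i => ((orderOf (Q i) - 1 : ℕ) : ℤ)) * w ∈ (toPiTorus hQ H).range := by
  have hn : ∀ i, (0 : ℤ) < orderOf (Q i) := fun i => by exact_mod_cast (hfin i).orderOf_pos
  rw [mem_range_toPiTorus]
  intro d
  have hδ := basis_tExp_mem_tPoly hQ fun i => orderOf (Q i) - 1
  have hproj := proj_mul_left (xDeg r) (tPoly_le_supported hQ hδ) d w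
  rw [zero_add] at hproj
  rw [hproj]
  set wd := proj (piBichar hQ) (xDeg r ⁻¹' {d}) w with hwd
  have hwd' : wd ∈ supported (piBichar hQ) (xDeg r ⁻¹' {d}) := proj_mem _ _
  set s : Fin r → ℤ := fun i => d i * (orderOf (Q i) - 1) with hs
  have hds : ∀ i, (0 ≤ d i ∧ 0 ≤ s i) ∨ (d i ≤ 0 ∧ s i ≤ 0) := fun i => by
    have h1 : (0 : ℤ) ≤ orderOf (Q i) - 1 := by have := hn i; omega
    rcases le_total 0 (d i) with h2 | h2
    · exact Or.inl ⟨h2, mul_nonneg h2 h1⟩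
    · exact Or.inr ⟨h2, mul_nonpos_of_nonpos_of_nonneg h2 h1⟩
  have hX := torusX_mem hQ H s
  have hwX : wd * torusX hQ H s ∈ supported (piBichar hQ) {g | ∀ i, Q i ^ (g i).2 = 1} := by
    refine supported_mono (fun g hg i => ?_) (mul_mem_supported_preimage (xDeg r) hwd' hX)
    rw [show (g i).2 = d i + s i from congrFun hg i, hs, ← orderOf_dvd_iff_zpow_eq_one_of_ne_zero (hQ i)]
    exact ⟨d i, by ring⟩
  have key : ∀ e : Fin r → ℕ, ∃ f ∈ tPoly hQ,
      trace hQ (basis _ (tExp fun i => (e i : ℤ)) * (wd * torusX hQ H s)) =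
        f * torusX hQ H (d + s) := by
    intro e
    have he := basis_tExp_mem_tPoly hQ e
    have h1 := hw (torusX hQ H s * basis _ (tExp fun i => (e i : ℤ)))
      (mul_mem ⟨_, rfl⟩ (mem_range_of_mem_tPoly hQ he))
    obtain ⟨f, hf, h2⟩ := (mem_range_toPiTorus hQ).1 h1 (d + s)
    have h3 := proj_mul_left (xDeg r) (tPoly_le_supported hQ he) (d + s) (w * torusX hQ H s)
    rw [proj_mul_right (xDeg r) hX, zero_add] at h3
    refine ⟨f, hf, ?_⟩
    rw [← h2, ← h3, ← mul_assoc w, trace, proj_radical_mul_comm _ (basis _ _), proj_proj_comm]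
  choose f hf hf' using key
  have hsum := sum_tBox hQ hfin hwX
  simp only [hf'] at hsum
  refine ⟨∑ e ∈ Fintype.piFinset fun i => Finset.range (orderOf (Q i)),
      basis _ (tExp fun i => ((orderOf (Q i) - 1 - e i : ℕ) : ℤ)) * f e,
      sum_mem fun e _ => mul_mem_tPoly hQ (basis_tExp_mem_tPoly hQ _) (hf e), ?_⟩
  refine mul_right_cancel₀ (torusX_ne_zero hQ hH s) ?_
  rw [mul_assoc, ← hsum, Finset.sum_mul, Finset.sum_mul]
  refine Finset.sum_congr rfl fun e _ => ?_
  rw [← torusX_mul_torusX hQ H hds]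
  simp only [mul_assoc]

theorem isConductor_tPow (hH : ∀ i, H i ≠ 0) (hfin : ∀ i, IsOfFinOrder (Q i)) :
    IsConductor k (tPow Q H fun i => orderOf (Q i) - 1) := by
  have hQ : ∀ i, Q i ≠ 0 := fun i => (hfin i).isUnit.ne_zero
  intro b z hbz
  obtain ⟨w, hbw, hw⟩ := exists_of_isDualPair hQ hH hfin hbz
  obtain ⟨c, hc⟩ := basis_mul_mem_range_of_trace hQ hH hfin hw
  change toPiTorus hQ H c = _ at hc
  refine ⟨c, toPiTorus_injective hQ hH ?_⟩
  rw [map_mul, map_mul, hc, hbw, toPiTorus_tPow, ← mul_assoc, ← mul_assoc,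
    commute_of_mem_supported_radical ((mem_center_iff_toPiTorus hQ hH).1 hbz.1)]

end Trace

/-! ### Divisors of monomials in the `tᵢ` -/

section Divisors

open TwistedAlgebra

variable {r : ℕ} {Q : Fin r → k} {H : Fin r → k[X]}

variable (Q H) in
theorem tPow_mul_tPow (e e' : Fin r → ℕ) : tPow Q H e * tPow Q H e' = tPow Q H (e + e') := by
  rw [tPow, tPow, PiTensorProduct.tprod_mul_tprod, tPow]
  congr 1
  ext i
  exact (pow_add _ _ _).symm

variable (Q H) in
theorem tPow_zero : tPow Q H 0 = 1 := by
  rw [tPow, PiTensorProduct.one_def]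
  congr 1
  ext i
  exact pow_zero _

theorem tensorGWA_smul_mul (α : k) (a b : TensorGWA Q H) : α • a * b = α • (a * b) :=
  Algebra.smul_mul_assoc _ _ _

theorem tensorGWA_mul_smul (α : k) (a b : TensorGWA Q H) : a * α • b = α • (a * b) :=
  Algebra.mul_smul_comm _ _ _

theorem tensorGWA_mul_left_cancel (hQ : ∀ i, Q i ≠ 0) (hH : ∀ i, H i ≠ 0) {a b c : TensorGWA Q H}
    (ha : a ≠ 0) (h : a * b = a * c) : b = c := by
  have hinj := toPiTorus_injective hQ hH
  refine hinj (mul_left_cancel₀ ((map_ne_zero_iff _ hinj).2 ha) ?_)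
  rw [← map_mul, ← map_mul, h]

theorem tensorGWA_mul_right_cancel (hQ : ∀ i, Q i ≠ 0) (hH : ∀ i, H i ≠ 0) {a b c : TensorGWA Q H}
    (ha : a ≠ 0) (h : b * a = c * a) : b = c := by
  have hinj := toPiTorus_injective hQ hH
  refine hinj (mul_right_cancel₀ ((map_ne_zero_iff _ hinj).2 ha) ?_)
  rw [← map_mul, ← map_mul, h]

theorem tPow_ne_zero (hQ : ∀ i, Q i ≠ 0) (e : Fin r → ℕ) : tPow Q H e ≠ 0 := by
  intro h0
  have h1 := toPiTorus_tPow hQ H e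
  rw [h0, map_zero] at h1
  exact (basis (piBichar hQ)).ne_zero _ h1.symm

theorem exists_repr_mul_torusX (hQ : ∀ i, Q i ≠ 0) (hH : ∀ i, H i ≠ 0) {f : TwistedAlgebra (piBichar hQ)}
    {a : Fin r → ℤ × ℤ} (ha : (basis _).repr f a ≠ 0) (d : Fin r → ℤ) (l : Fin r) :
    ∃ g, (basis _).repr (f * torusX hQ H d) g ≠ 0 ∧
      (a l).1 + (H l).natDegree * max 0 (-d l) ≤ (g l).1 := by
  obtain ⟨b, hb, hb'⟩ := exists_repr_torusX hQ hH d
  obtain ⟨g, hg, hle⟩ := exists_repr_mul_ne_zero (tDeg l) ha hb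
  exact ⟨g, hg, (add_le_add_right (hb' l) _).trans hle⟩

theorem exists_tPoly_of_mem_supported (hQ : ∀ i, Q i ≠ 0) {u : TensorGWA Q H} {d : Fin r → ℤ}
    (hu : toPiTorus hQ H u ∈ supported (piBichar hQ) (xDeg r ⁻¹' {d})) :
    ∃ f ∈ tPoly hQ, toPiTorus hQ H u = f * torusX hQ H d := by
  obtain ⟨f, hf, h1⟩ := proj_toPiTorus hQ u d
  exact ⟨f, hf, by rw [← h1, proj_eq_self hu]⟩

theorem exists_repr_of_ne_zero {G : Type*} [AddCommGroup G] {χ : Bicharacter k G}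
    {u : TwistedAlgebra χ} (hu : u ≠ 0) : ∃ a, (basis χ).repr u a ≠ 0 := by
  by_contra! hcon
  exact hu ((basis χ).repr.injective (by ext a; simpa using hcon a))

theorem le_of_toPiTorus_eq_smul_basis (hQ : ∀ i, Q i ≠ 0) (hH : ∀ i, H i ≠ 0) {u : TensorGWA Q H} {c : k}
    {g : Fin r → ℤ × ℤ} (hc : c ≠ 0) (hu : toPiTorus hQ H u = c • basis _ g) (l : Fin r) :
    (H l).natDegree * max 0 (-(g l).2) ≤ (g l).1 := by
  classical
  obtain ⟨f, hf, h1⟩ := exists_tPoly_of_mem_supported hQ (u := u) (d := xDeg r g)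
    (hu ▸ Submodule.smul_mem _ c (basis_mem_supported rfl))
  have hf0 : f ≠ 0 := by
    rintro rfl
    rw [zero_mul, hu] at h1
    exact smul_ne_zero hc ((basis (piBichar hQ)).ne_zero g) h1
  obtain ⟨a, ha⟩ := exists_repr_of_ne_zero hf0
  obtain ⟨g', hg', hle⟩ := exists_repr_mul_torusX hQ hH ha (xDeg r g) l
  rw [← h1, hu, map_smul, Module.Basis.repr_self, Finsupp.smul_apply, Finsupp.single_apply] at hg'
  split_ifs at hg' with h2
  · rw [h2]
    have h3 := (mem_supported.1 hf a ha l).1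
    rw [← h2] at hle ⊢
    exact (le_add_of_nonneg_left h3).trans hle
  · simp at hg'

/-- Factors of a squarefree monomial in the `tᵢ` are monomials. -/
theorem exists_eq_smul_tPow_of_mul_eq (hQ : ∀ i, Q i ≠ 0) (hH : ∀ i, 2 ≤ (H i).natDegree) {u v : TensorGWA Q H} {c : k}
    (hc : c ≠ 0) {n : Fin r → ℕ} (hn : ∀ i, n i ≤ 1) (huv : u * v = c • tPow Q H n) :
    ∃ e : Fin r → ℕ, ∃ α : k, α ≠ 0 ∧ e ≤ n ∧ u = α • tPow Q H e := by
  have hH0 : ∀ i, H i ≠ 0 := fun i h0 => by simpa [h0] using hH i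
  have h1 : toPiTorus hQ H u * toPiTorus hQ H v = c • basis _ (tExp fun i => (n i : ℤ)) := by
    rw [← map_mul, huv, map_smul, toPiTorus_tPow]
  have hne : toPiTorus hQ H u * toPiTorus hQ H v ≠ 0 := by
    rw [h1]
    exact smul_ne_zero hc ((basis (piBichar hQ)).ne_zero _)
  obtain ⟨g, g', hgg, hu, hv⟩ := homogeneous_of_mul_homogeneous (AddMonoidHom.id (Fin r → ℤ × ℤ))
    (c := tExp fun i => (n i : ℤ)) (h1 ▸ Submodule.smul_mem _ c (basis_mem_supported rfl)) hne
  have hu' := (proj_eq_self hu).symm.trans (proj_id_singleton _ g)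
  have hv' := (proj_eq_self hv).symm.trans (proj_id_singleton _ g')
  have hα : (basis _).repr (toPiTorus hQ H u) g ≠ 0 := by
    intro h0
    rw [h0, zero_smul] at hu'
    rw [hu', zero_mul] at hne
    exact hne rfl
  have hβ : (basis _).repr (toPiTorus hQ H v) g' ≠ 0 := by
    intro h0
    rw [h0, zero_smul] at hv'
    rw [hv', mul_zero] at hne
    exact hne rfl
  have hg : ∀ i, 0 ≤ (g i).1 ∧ (g i).1 ≤ n i ∧ (g i).2 = 0 := by
    intro i
    have h2 := le_of_toPiTorus_eq_smul_basis hQ hH0 hα hu' i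
    have h3 := le_of_toPiTorus_eq_smul_basis hQ hH0 hβ hv' i
    have h4 : (g i).1 + (g' i).1 = n i := congrArg Prod.fst (congrFun hgg i)
    have h5 : (g i).2 + (g' i).2 = 0 := congrArg Prod.snd (congrFun hgg i)
    have h6 : (2 : ℤ) ≤ (H i).natDegree := by exact_mod_cast hH i
    have h7 := hn i
    have h8 : 2 * max 0 (-(g i).2) ≤ (g i).1 :=
      (mul_le_mul_of_nonneg_right h6 (le_max_left _ _)).trans h2
    have h9 : 2 * max 0 (-(g' i).2) ≤ (g' i).1 :=
      (mul_le_mul_of_nonneg_right h6 (le_max_left _ _)).trans h3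
    omega
  refine ⟨fun i => (g i).1.toNat, _, hα, fun i => by have := hg i; simp only; omega,
    toPiTorus_injective hQ hH0 ?_⟩
  rw [map_smul, toPiTorus_tPow]
  refine hu'.trans ?_
  congr 2
  ext i
  · have := hg i
    simp only [tExp]
    omega
  · exact (hg i).2.2

theorem exists_eq_smul_one_of_mul_eq_one (hQ : ∀ i, Q i ≠ 0) (hH : ∀ i, 2 ≤ (H i).natDegree) {u v : TensorGWA Q H}
    (huv : u * v = 1) : ∃ α : k, α ≠ 0 ∧ u = α • 1 := by
  obtain ⟨e, α, hα, he, hu⟩ := exists_eq_smul_tPow_of_mul_eq hQ hH (u := u) (v := v) one_ne_zero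
    (n := 0) (by simp) (by rw [huv, tPow_zero, one_smul])
  rw [le_antisymm he (zero_le), tPow_zero] at hu
  exact ⟨α, hα, hu⟩

end Divisors

/-! ### Automorphisms fix the product of the `tᵢ` up to a scalar -/

section ProductOfT

open TwistedAlgebra

variable {r : ℕ} {Q : Fin r → k} {H : Fin r → k[X]}

theorem mem_radical_tExp (hQ : ∀ i, Q i ≠ 0) {e : Fin r → ℤ} :
    tExp e ∈ radical (piBichar hQ) ↔ ∀ i, (orderOf (Q i) : ℤ) ∣ e i := by
  rw [mem_radical_piBichar]
  refine forall_congr' fun i => ?_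
  simp [tExp, orderOf_dvd_iff_zpow_eq_one_of_ne_zero (hQ i)]

theorem tPow_orderOf_mem_center (hQ : ∀ i, Q i ≠ 0) (hH : ∀ i, H i ≠ 0) :
    tPow Q H (fun i => orderOf (Q i)) ∈ Subalgebra.center k (TensorGWA Q H) := by
  rw [mem_center_iff_toPiTorus hQ hH, toPiTorus_tPow]
  exact basis_mem_supported ((mem_radical_tExp hQ).2 fun i => dvd_rfl)

theorem basis_neg_mul_trace_mem_tPoly (hQ : ∀ i, Q i ≠ 0) {f : TwistedAlgebra (piBichar hQ)} (hf : f ∈ tPoly hQ) :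
    basis _ (tExp fun i => -(orderOf (Q i) : ℤ)) *
      trace hQ (basis _ (tExp fun _ => 1) * f) ∈ tPoly hQ := by
  classical
  induction hf using tPoly_induction with
  | zero => simp
  | add u u' _ _ hu hu' => simp only [mul_add, map_add]; exact add_mem hu hu'
  | smul c u _ hu => simp only [mul_smul_comm, map_smul]; exact Submodule.smul_mem _ c hu
  | basis e =>
    rw [basis_tExp_mul, trace, proj_basis]
    split_ifs with h1
    · rw [basis_tExp_mul]
      refine basis_mem_supported fun i => ⟨?_, rfl⟩
      have h2 := Int.le_of_dvd (by simp only [Pi.add_apply]; omega) ((mem_radical_tExp hQ).1 h1 i)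
      simp only [tExp, Pi.add_apply] at h2 ⊢
      omega
    · rw [mul_zero]
      exact zero_mem _

theorem isDualPair_tPow (hH : ∀ i, H i ≠ 0) (hfin : ∀ i, IsOfFinOrder (Q i)) :
    IsDualPair k (tPow Q H 1) (tPow Q H fun i => orderOf (Q i)) := by
  classical
  have hQ : ∀ i, Q i ≠ 0 := fun i => (hfin i).isUnit.ne_zero
  refine ⟨tPow_orderOf_mem_center hQ hH, tPow_ne_zero hQ _, fun c => ?_⟩
  have hp : toPiTorus hQ H (tPow Q H 1) = basis _ (tExp fun _ => 1) := by
    rw [toPiTorus_tPow]; simp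
  have hp0 : basis (piBichar hQ) (tExp fun _ => 1) ∈ tPoly hQ :=
    basis_mem_supported fun i => by simp [tExp]
  have hT : basis (piBichar hQ) (tExp fun i => -(orderOf (Q i) : ℤ)) ∈
      supported (piBichar hQ) (xDeg r ⁻¹' {0}) := basis_mem_supported rfl
  obtain ⟨a, ha⟩ : basis _ (tExp fun i => -(orderOf (Q i) : ℤ)) *
      trace hQ (basis _ (tExp fun _ => 1) * toPiTorus hQ H c) ∈ (toPiTorus hQ H).range := by
    rw [mem_range_toPiTorus]
    intro d
    obtain ⟨f, hf, h1⟩ := proj_toPiTorus hQ c d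
    have h2 := proj_mul_left (xDeg r) hT d
      (trace hQ (basis _ (tExp fun _ => 1) * toPiTorus hQ H c))
    have h3 := proj_mul_left (xDeg r) (tPoly_le_supported hQ hp0) d (toPiTorus hQ H c)
    have h4 := trace_mul_torusX (H := H) hQ (mul_mem_tPoly hQ hp0 hf) d
    rw [zero_add] at h2 h3
    rw [trace] at h4
    rw [h2, trace, proj_proj_comm, h3, h1, ← mul_assoc, h4, ← mul_assoc]
    refine ⟨_, ?_, rfl⟩
    split_ifs
    · exact basis_neg_mul_trace_mem_tPoly hQ hf
    · rw [mul_zero]; exact zero_mem _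
  change toPiTorus hQ H a = _ at ha
  refine ⟨a, (isCommSat_iff hQ hH hfin).2 ?_⟩
  have h5 : toPiTorus hQ H (tPow Q H 1 * c - (tPow Q H fun i => orderOf (Q i)) * a) =
      basis _ (tExp fun _ => 1) * toPiTorus hQ H c -
        trace hQ (basis _ (tExp fun _ => 1) * toPiTorus hQ H c) := by
    rw [map_sub, map_mul, map_mul, ha, hp, toPiTorus_tPow, ← mul_assoc, basis_tExp_mul]
    rw [show (fun i => (orderOf (Q i) : ℤ)) + (fun i => -(orderOf (Q i) : ℤ)) = 0 by
      ext i; simp, show tExp (0 : Fin r → ℤ) = 0 from rfl, basis_zero, one_mul]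
  rw [h5, map_sub, sub_eq_zero]
  exact (proj_eq_self (proj_mem _ _)).symm

theorem tPow_mul_tPow_one (hfin : ∀ i, IsOfFinOrder (Q i)) :
    (tPow Q H fun i => orderOf (Q i) - 1) * tPow Q H 1 = tPow Q H fun i => orderOf (Q i) := by
  rw [tPow_mul_tPow]
  congr 1
  ext i
  have := (hfin i).orderOf_pos
  simp only [Pi.add_apply, Pi.one_apply]
  omega

theorem exists_eq_mul_tPow_of_isConductor (hH : ∀ i, H i ≠ 0) (hfin : ∀ i, IsOfFinOrder (Q i))
    {a : TensorGWA Q H} (ha : IsConductor k a) :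
    ∃ c, a = c * tPow Q H fun i => orderOf (Q i) - 1 := by
  have hQ : ∀ i, Q i ≠ 0 := fun i => (hfin i).isUnit.ne_zero
  obtain ⟨c, hc⟩ := ha _ _ (isDualPair_tPow hH hfin)
  refine ⟨c, tensorGWA_mul_right_cancel hQ hH (tPow_ne_zero hQ 1) ?_⟩
  rw [hc, mul_assoc, tPow_mul_tPow_one hfin,
    Subalgebra.mem_center_iff.1 (tPow_orderOf_mem_center hQ hH)]

theorem exists_map_tPow_orderOf_sub_one (hH : ∀ i, 2 ≤ (H i).natDegree)
    (hfin : ∀ i, IsOfFinOrder (Q i)) (φ : TensorGWA Q H ≃ₐ[k] TensorGWA Q H) :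
    ∃ α : k, α ≠ 0 ∧ φ (tPow Q H fun i => orderOf (Q i) - 1) =
      α • tPow Q H fun i => orderOf (Q i) - 1 := by
  have hQ : ∀ i, Q i ≠ 0 := fun i => (hfin i).isUnit.ne_zero
  have hH0 : ∀ i, H i ≠ 0 := fun i h0 => by simpa [h0] using hH i
  obtain ⟨a, ha⟩ := exists_eq_mul_tPow_of_isConductor hH0 hfin
    ((isConductor_tPow (H := H) hH0 hfin).map φ)
  obtain ⟨b, hb⟩ := exists_eq_mul_tPow_of_isConductor hH0 hfin
    ((isConductor_tPow (H := H) hH0 hfin).map φ.symm)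
  have h1 : φ b * a = 1 := by
    refine tensorGWA_mul_right_cancel hQ hH0 (tPow_ne_zero hQ fun i => orderOf (Q i) - 1) ?_
    have h2 := congrArg φ hb
    rw [map_mul, AlgEquiv.apply_symm_apply, ha] at h2
    rw [mul_assoc, one_mul, ← h2]
  obtain ⟨α, hα, h3⟩ := exists_eq_smul_one_of_mul_eq_one hQ hH h1
  refine ⟨α⁻¹, inv_ne_zero hα, ?_⟩
  rw [h3, tensorGWA_smul_mul, one_mul] at h1
  rw [ha, eq_inv_smul_iff₀ hα, ← tensorGWA_smul_mul, h1, one_mul]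

theorem basis_neg_one_mul_mem_tPoly (hQ : ∀ i, Q i ≠ 0) (hQ1 : ∀ i, Q i ≠ 1)
    (hfin : ∀ i, IsOfFinOrder (Q i)) {f : TwistedAlgebra (piBichar hQ)} (hf : f ∈ tPoly hQ)
    (hf' : basis _ (tExp fun i => ((orderOf (Q i) - 1 : ℕ) : ℤ)) * f ∈
      supported (piBichar hQ) (radical (piBichar hQ))) :
    basis _ (tExp fun _ => -1) * f ∈ tPoly hQ := by
  have h1 : f ∈ supported (piBichar hQ) {g | ∀ i, 1 ≤ (g i).1 ∧ (g i).2 = 0} := by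
    rw [mem_supported]
    intro g hg i
    have h2 := mem_supported.1 hf g hg i
    have h3 := mem_supported.1 hf' (tExp (fun i => ((orderOf (Q i) - 1 : ℕ) : ℤ)) + g) (by
      rw [repr_basis_mul]
      exact mul_ne_zero ((piBichar hQ).ne_zero _ _) hg)
    have h4 := (orderOf_dvd_iff_zpow_eq_one_of_ne_zero (hQ i)).2
      ((mem_radical_piBichar hQ).1 h3 i).1
    simp only [tExp, Pi.add_apply, Prod.fst_add] at h4
    have h5 := (hfin i).orderOf_pos
    have h6 : orderOf (Q i) ≠ 1 := fun h => hQ1 i (orderOf_eq_one_iff.1 h)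
    refine ⟨?_, h2.2⟩
    by_contra h7
    have h8 : (g i).1 = 0 := by have := h2.1; omega
    rw [h8, add_zero] at h4
    have := Int.le_of_dvd (by omega) h4
    omega
  refine mul_mem_supported (fun a ha b hb i => ?_)
    (basis_mem_supported (S := {tExp fun _ => -1}) rfl) h1
  rw [Set.mem_singleton_iff.1 ha]
  have := hb i
  simp only [tExp, Pi.add_apply, Prod.fst_add, Prod.snd_add]
  omega

theorem exists_eq_tPow_one_mul (hH : ∀ i, H i ≠ 0) (hfin : ∀ i, IsOfFinOrder (Q i))
    (hQ1 : ∀ i, Q i ≠ 1) {u : TensorGWA Q H}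
    (hu : (tPow Q H fun i => orderOf (Q i) - 1) * u ∈ Subalgebra.center k (TensorGWA Q H)) :
    ∃ a, u = tPow Q H 1 * a := by
  classical
  have hQ : ∀ i, Q i ≠ 0 := fun i => (hfin i).isUnit.ne_zero
  rw [mem_center_iff_toPiTorus hQ hH, map_mul, toPiTorus_tPow] at hu
  have hδ := basis_tExp_mem_tPoly hQ fun i => orderOf (Q i) - 1
  obtain ⟨a, ha⟩ : basis _ (tExp fun _ => -1) * toPiTorus hQ H u ∈ (toPiTorus hQ H).range := by
    rw [mem_range_toPiTorus]
    intro d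
    obtain ⟨f, hf, h1⟩ := proj_toPiTorus hQ u d
    have h2 := proj_mul_left (xDeg r) (basis_mem_supported (χ := piBichar hQ)
      (show tExp (fun _ => -1) ∈ xDeg r ⁻¹' {0} from rfl)) d (toPiTorus hQ H u)
    have h3 := proj_mul_left (xDeg r) (tPoly_le_supported hQ hδ) d (toPiTorus hQ H u)
    rw [zero_add] at h2 h3
    rw [h2, h1, ← mul_assoc]
    refine ⟨_, basis_neg_one_mul_mem_tPoly hQ hQ1 hfin hf ?_, rfl⟩
    have h4 := trace_mul_torusX (H := H) hQ (mul_mem_tPoly hQ hδ hf) d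
    rw [mul_assoc, ← h1, ← h3, trace, proj_proj_comm, proj_eq_self hu, h3, h1, ← mul_assoc] at h4
    rw [mul_right_cancel₀ (torusX_ne_zero hQ hH d) h4]
    split_ifs
    · exact proj_mem _ _
    · exact zero_mem _
  change toPiTorus hQ H a = _ at ha
  refine ⟨a, toPiTorus_injective hQ hH ?_⟩
  rw [map_mul, ha, toPiTorus_tPow, ← mul_assoc, basis_tExp_mul,
    show (fun i => ((1 : Fin r → ℕ) i : ℤ)) + (fun _ => -1) = 0 by ext i; simp,
    show tExp (0 : Fin r → ℤ) = 0 from rfl, basis_zero, one_mul]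

theorem mem_center_of_smul_mem_center {A : Type*} [Semiring A] [Algebra k A] {α : k} (hα : α ≠ 0)
    {z : A} (hz : α • z ∈ Subalgebra.center k A) : z ∈ Subalgebra.center k A := by
  simpa [inv_smul_smul₀ hα] using Subalgebra.smul_mem _ hz α⁻¹

theorem exists_map_tPow_one_eq_mul (hH : ∀ i, 2 ≤ (H i).natDegree)
    (hfin : ∀ i, IsOfFinOrder (Q i)) (hQ1 : ∀ i, Q i ≠ 1)
    (φ : TensorGWA Q H ≃ₐ[k] TensorGWA Q H) : ∃ a, φ (tPow Q H 1) = tPow Q H 1 * a := by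
  have hQ : ∀ i, Q i ≠ 0 := fun i => (hfin i).isUnit.ne_zero
  have hH0 : ∀ i, H i ≠ 0 := fun i h0 => by simpa [h0] using hH i
  obtain ⟨α, hα, h1⟩ := exists_map_tPow_orderOf_sub_one hH hfin φ
  refine exists_eq_tPow_one_mul hH0 hfin hQ1 (mem_center_of_smul_mem_center hα ?_)
  have h2 : φ (tPow Q H fun i => orderOf (Q i)) ∈ Subalgebra.center k (TensorGWA Q H) :=
    center_map φ (tPow_orderOf_mem_center hQ hH0)
  have h3 : φ (tPow Q H fun i => orderOf (Q i)) =
      α • ((tPow Q H fun i => orderOf (Q i) - 1) * φ (tPow Q H 1)) := by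
    rw [← tensorGWA_smul_mul, ← h1, ← map_mul, tPow_mul_tPow_one hfin]
  exact h3 ▸ h2

/-- Automorphisms fix the product of the `tᵢ` up to a scalar. -/
theorem exists_map_tPow_one (hH : ∀ i, 2 ≤ (H i).natDegree)
    (hfin : ∀ i, IsOfFinOrder (Q i)) (hQ1 : ∀ i, Q i ≠ 1)
    (φ : TensorGWA Q H ≃ₐ[k] TensorGWA Q H) :
    ∃ α : k, α ≠ 0 ∧ φ (tPow Q H 1) = α • tPow Q H 1 := by
  have hQ : ∀ i, Q i ≠ 0 := fun i => (hfin i).isUnit.ne_zero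
  have hH0 : ∀ i, H i ≠ 0 := fun i h0 => by simpa [h0] using hH i
  obtain ⟨a, ha⟩ := exists_map_tPow_one_eq_mul hH hfin hQ1 φ
  obtain ⟨b, hb⟩ := exists_map_tPow_one_eq_mul hH hfin hQ1 φ.symm
  have h1 : a * φ b = 1 := by
    refine tensorGWA_mul_left_cancel hQ hH0 (tPow_ne_zero hQ 1) ?_
    have h2 := congrArg φ hb
    rw [map_mul, AlgEquiv.apply_symm_apply, ha] at h2
    rw [← mul_assoc, mul_one, ← h2]
  obtain ⟨α, hα, h3⟩ := exists_eq_smul_one_of_mul_eq_one hQ hH h1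
  exact ⟨α, hα, by rw [ha, h3, tensorGWA_mul_smul, mul_one]⟩

end ProductOfT

/-! ### The canonical embeddings of the tensor factors -/

section TensorEmb

open TwistedAlgebra

variable {r : ℕ} {Q : Fin r → k} {H : Fin r → k[X]}

variable (Q H) in
/-- The canonical embedding of a tensor factor as an algebra homomorphism. -/
noncomputable def gwaTensorEmbHom (i : Fin r) : GWA.One (Q i) (H i) →ₐ[k] TensorGWA Q H :=
  PiTensorProduct.singleAlgHom (R := k) (A := fun j => GWA.One (Q j) (H j)) i

variable (Q H) in
theorem gwaTensorEmbHom_apply (i : Fin r) (w : GWA.One (Q i) (H i)) :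
    gwaTensorEmbHom Q H i w = gwaTensorEmb Q H i w := by
  rw [gwaTensorEmb, gwaTensorEmbHom]
  refine (PiTensorProduct.singleAlgHom_apply ..).trans ?_
  rfl

variable (Q H) in
theorem gwaTensorEmb_t_pow (i : Fin r) (n : ℕ) :
    gwaTensorEmb Q H i (GWA.t ^ n) = tPow Q H (Pi.single i n) := by
  rw [gwaTensorEmb, tPow]
  congr 1
  ext j
  by_cases hj : j = i
  · subst hj; simp
  · simp [hj]

variable (Q H) in
theorem gwaTensorEmb_t (i : Fin r) : gwaTensorEmb Q H i GWA.t = tPow Q H (Pi.single i 1) := by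
  rw [← gwaTensorEmb_t_pow, pow_one]

variable (Q H) in
theorem gwaTensorEmb_pow (i : Fin r) (d : ℤ) :
    gwaTensorEmb Q H i (GWA.pow d) = xPow Q H (Pi.single i d) := by
  rw [gwaTensorEmb, xPow]
  congr 1
  ext j
  by_cases hj : j = i
  · subst hj; simp
  · simp [hj, GWA.pow_zero']

variable (Q H) in
theorem gwaTensorEmb_x (i : Fin r) :
    gwaTensorEmb Q H i (GWA.x 0) = xPow Q H (Pi.single i 1) := by
  rw [← gwaTensorEmb_pow, GWA.pow_one']

variable (Q H) in
theorem gwaTensorEmb_y (i : Fin r) :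
    gwaTensorEmb Q H i (GWA.y 0) = xPow Q H (Pi.single i (-1)) := by
  rw [← gwaTensorEmb_pow, GWA.pow_neg_one]

theorem toPiTorus_aeval_t (hQ : ∀ i, Q i ≠ 0) (j : Fin r) (p : k[X]) :
    toPiTorus hQ H (gwaTensorEmb Q H j (aeval GWA.t p)) =
      ∑ n ∈ Finset.range (p.natDegree + 1), p.coeff n • basis _ (tExp (Pi.single j (n : ℤ))) := by
  rw [← gwaTensorEmbHom_apply, aeval_eq_sum_range, map_sum, map_sum]
  refine Finset.sum_congr rfl fun n _ => ?_
  rw [map_smul, gwaTensorEmbHom_apply, gwaTensorEmb_t_pow, map_smul, toPiTorus_tPow]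
  congr 3
  ext l
  by_cases hl : l = j
  · subst hl; simp
  · simp [hl]

theorem repr_toPiTorus_aeval_t (hQ : ∀ i, Q i ≠ 0) (j : Fin r) (p : k[X]) (n : ℕ) :
    (basis _).repr (toPiTorus hQ H (gwaTensorEmb Q H j (aeval GWA.t p)))
      (tExp (Pi.single j (n : ℤ))) = p.coeff n := by
  classical
  have h1 : ∀ a : ℕ, tExp (Pi.single j (a : ℤ)) = tExp (Pi.single j (n : ℤ)) ↔ a = n := by
    refine fun a => ⟨fun h => ?_, fun h => by rw [h]⟩
    have h2 := congrArg Prod.fst (congrFun h j)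
    simpa [tExp] using h2
  rw [toPiTorus_aeval_t, map_sum, Finsupp.finsetSum_apply]
  simp only [map_smul, Module.Basis.repr_self, Finsupp.smul_apply, Finsupp.single_apply, h1,
    smul_eq_mul, mul_ite, mul_one, mul_zero, Finset.sum_ite_eq', Finset.mem_range]
  split_ifs with h2
  · rfl
  · exact (coeff_eq_zero_of_natDegree_lt (by omega)).symm

theorem toPiTorus_aeval_t_mem (hQ : ∀ i, Q i ≠ 0) (j : Fin r) (p : k[X]) :
    toPiTorus hQ H (gwaTensorEmb Q H j (aeval GWA.t p)) ∈ supported (piBichar hQ)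
      {g | (∀ l, (g l).1 ≤ (Pi.single j (p.natDegree : ℤ) : Fin r → ℤ) l) ∧ xDeg r g = 0} := by
  rw [toPiTorus_aeval_t]
  refine Submodule.sum_mem _ fun n hn => Submodule.smul_mem _ _ (basis_mem_supported
    ⟨fun l => ?_, rfl⟩)
  by_cases hl : l = j
  · subst hl
    have := Finset.mem_range.1 hn
    simp only [tExp, Pi.single_eq_same]
    omega
  · simp [tExp, hl]

theorem aeval_t_injective (hQ : ∀ i, Q i ≠ 0) (j : Fin r) {p p' : k[X]}
    (h : gwaTensorEmb Q H j (aeval GWA.t p) = gwaTensorEmb Q H j (aeval GWA.t p')) : p = p' := by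
  ext n
  rw [← repr_toPiTorus_aeval_t (H := H) hQ j p n, h, repr_toPiTorus_aeval_t]

theorem tPow_eq_of_smul_eq_smul (hQ : ∀ i, Q i ≠ 0) {a b : k} (ha : a ≠ 0) {e e' : Fin r → ℕ}
    (h : a • tPow Q H e = b • tPow Q H e') : e = e' := by
  classical
  have h1 := congrArg (toPiTorus hQ H) h
  rw [map_smul, map_smul, toPiTorus_tPow, toPiTorus_tPow] at h1
  have h2 := congrArg (fun u => (basis (piBichar hQ)).repr u (tExp fun i => (e i : ℤ))) h1
  simp only [map_smul, Module.Basis.repr_self, Finsupp.smul_apply, Finsupp.single_apply,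
    if_true, smul_eq_mul, mul_one] at h2
  by_contra hne
  rw [if_neg, mul_zero] at h2
  · exact ha h2
  · intro h3
    refine hne (funext fun i => ?_)
    simpa [tExp] using (congrArg Prod.fst (congrFun h3 i)).symm

end TensorEmb

/-! ### Images of the generators -/

section Generators

open TwistedAlgebra

variable {r : ℕ} {Q : Fin r → k} {H : Fin r → k[X]}

theorem exists_map_tPow_single_eq_smul_tPow (hH : ∀ i, 2 ≤ (H i).natDegree)
    (hfin : ∀ i, IsOfFinOrder (Q i)) (hQ1 : ∀ i, Q i ≠ 1)
    (φ : TensorGWA Q H ≃ₐ[k] TensorGWA Q H) (i : Fin r) :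
    ∃ e : Fin r → ℕ, ∃ α : k, α ≠ 0 ∧ e ≠ 0 ∧ e ≤ 1 ∧
      φ (tPow Q H (Pi.single i 1)) = α • tPow Q H e := by
  have hQ : ∀ i, Q i ≠ 0 := fun i => (hfin i).isUnit.ne_zero
  obtain ⟨c, hc, h1⟩ := exists_map_tPow_one hH hfin hQ1 φ
  have hs : (Pi.single i 1 : Fin r → ℕ) ≤ 1 := by
    intro l
    by_cases hl : l = i
    · subst hl; simp
    · simp [hl]
  have h2 : φ (tPow Q H (Pi.single i 1)) * φ (tPow Q H (1 - Pi.single i 1)) = c • tPow Q H 1 := by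
    rw [← map_mul, tPow_mul_tPow, add_tsub_cancel_of_le hs, h1]
  obtain ⟨e, α, hα, he, h3⟩ := exists_eq_smul_tPow_of_mul_eq hQ hH hc (fun _ => le_rfl) h2
  refine ⟨e, α, hα, ?_, he, h3⟩
  rintro rfl
  have h4 : (1 : k) • tPow Q H (Pi.single i 1) = α • tPow Q H 0 := by
    apply φ.injective
    rw [one_smul, h3, map_smul, tPow_zero, map_one]
  have h5 := congrFun (tPow_eq_of_smul_eq_smul hQ one_ne_zero h4) i
  simp at h5

theorem exists_map_tPow_single (hH : ∀ i, 2 ≤ (H i).natDegree)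
    (hfin : ∀ i, IsOfFinOrder (Q i)) (hQ1 : ∀ i, Q i ≠ 1)
    (φ : TensorGWA Q H ≃ₐ[k] TensorGWA Q H) (i : Fin r) :
    ∃ j : Fin r, ∃ γ : k, γ ≠ 0 ∧
      φ (tPow Q H (Pi.single i 1)) = γ • tPow Q H (Pi.single j 1) := by
  have hQ : ∀ i, Q i ≠ 0 := fun i => (hfin i).isUnit.ne_zero
  obtain ⟨e, α, hα, he0, he1, h1⟩ := exists_map_tPow_single_eq_smul_tPow hH hfin hQ1 φ i
  obtain ⟨j, hj⟩ := Function.ne_iff.1 he0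
  have hje : (Pi.single j 1 : Fin r → ℕ) ≤ e := by
    intro l
    by_cases hl : l = j
    · subst hl
      simpa [Nat.one_le_iff_ne_zero] using hj
    · simp [hl]
  obtain ⟨f, β, hβ, hf0, -, h2⟩ := exists_map_tPow_single_eq_smul_tPow hH hfin hQ1 φ.symm j
  have h3 : φ.symm (tPow Q H (Pi.single j 1)) * φ.symm (tPow Q H (e - Pi.single j 1)) =
      α⁻¹ • tPow Q H (Pi.single i 1) := by
    rw [← map_mul, tPow_mul_tPow, add_tsub_cancel_of_le hje, eq_inv_smul_iff₀ hα, ← map_smul, ← h1,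
      AlgEquiv.symm_apply_apply]
  obtain ⟨f', β', hβ', hf', h4⟩ := exists_eq_smul_tPow_of_mul_eq hQ hH (inv_ne_zero hα)
    (fun l => by by_cases hl : l = i <;> [(subst hl; simp); simp [hl]]) h3
  obtain rfl := tPow_eq_of_smul_eq_smul hQ hβ (h2.symm.trans h4)
  have hfi : f = Pi.single i 1 := by
    have h5 : ∀ l, l ≠ i → f l = 0 := fun l hl => by simpa [hl] using hf' l
    have h6 : f i ≤ 1 := by simpa using hf' i
    ext l
    by_cases hl : l = i
    · subst hl
      obtain ⟨m, hm⟩ := Function.ne_iff.1 hf0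
      have : m = l := by by_contra hml; exact hm (h5 m hml)
      subst this
      simp only [Pi.zero_apply, ne_eq] at hm
      simp only [Pi.single_eq_same]
      omega
    · simp [hl, h5 l hl]
  refine ⟨j, β⁻¹, inv_ne_zero hβ, ?_⟩
  rw [eq_inv_smul_iff₀ hβ, ← map_smul, ← hfi, ← h2, AlgEquiv.apply_symm_apply]

end Generators

/-! ### Factors of polynomials in `tⱼ` -/

section PolynomialFactors

open TwistedAlgebra

variable {r : ℕ} {Q : Fin r → k} {H : Fin r → k[X]}

theorem eq_repr_zero_smul_one {G : Type*} [AddCommGroup G] {χ : Bicharacter k G}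
    {f : TwistedAlgebra χ} (hf : ∀ g, (basis χ).repr f g ≠ 0 → g = 0) :
    f = (basis χ).repr f 0 • 1 := by
  have h1 : f ∈ supported χ (AddMonoidHom.id G ⁻¹' {0}) := mem_supported.2 hf
  rw [← basis_zero, ← proj_id_singleton, proj_eq_self h1]

theorem torusX_zero (hQ : ∀ i, Q i ≠ 0) : torusX hQ H 0 = 1 := by
  have h1 : xPow Q H 0 = 1 := by
    rw [xPow, PiTensorProduct.one_def]
    congr 1
    ext i
    exact GWA.pow_zero'
  rw [torusX, h1, map_one]

/-- Degree estimates for factorizations of a polynomial in `tⱼ`. -/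
theorem exists_factor_of_mul_eq_aeval (hQ : ∀ i, Q i ≠ 0) (hH : ∀ i, H i ≠ 0) {j : Fin r}
    {u v : TensorGWA Q H} {p : k[X]} (hp : p ≠ 0)
    (huv : u * v = gwaTensorEmb Q H j (aeval GWA.t p)) :
    ∃ d : Fin r → ℤ, ∃ f ∈ tPoly hQ, ∃ g ∈ tPoly hQ,
      toPiTorus hQ H u = f * torusX hQ H d ∧ toPiTorus hQ H v = g * torusX hQ H (-d) ∧
      f ≠ 0 ∧ g ≠ 0 ∧
      ∀ a b, (basis _).repr f a ≠ 0 → (basis _).repr g b ≠ 0 → ∀ l,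
        (a l).1 + (b l).1 + (H l).natDegree * |d l| ≤
          (Pi.single j (p.natDegree : ℤ) : Fin r → ℤ) l := by
  have h1 := toPiTorus_aeval_t_mem (H := H) hQ j p
  have hne : toPiTorus hQ H (u * v) ≠ 0 := by
    rw [huv]
    intro h0
    refine hp (Polynomial.ext fun n => ?_)
    rw [← repr_toPiTorus_aeval_t (H := H) hQ j p n, h0]
    simp
  rw [← huv] at h1
  have hne' := hne
  rw [map_mul] at hne'
  obtain ⟨d, d', hdd, hu, hv⟩ := homogeneous_of_mul_homogeneous (xDeg r) (c := 0)
    (u := toPiTorus hQ H u) (v := toPiTorus hQ H v)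
    (by rw [← map_mul]; exact supported_mono (fun g hg => hg.2) h1) hne'
  obtain rfl := (neg_eq_of_add_eq_zero_right hdd).symm
  obtain ⟨f, hf, hfu⟩ := exists_tPoly_of_mem_supported hQ hu
  obtain ⟨g, hg, hgv⟩ := exists_tPoly_of_mem_supported hQ hv
  refine ⟨d, f, hf, g, hg, hfu, hgv, ?_, ?_, fun a b ha hb l => ?_⟩
  · rintro rfl
    rw [hfu, zero_mul, zero_mul] at hne'
    exact hne' rfl
  · rintro rfl
    rw [hgv, zero_mul, mul_zero] at hne'
    exact hne' rfl
  · obtain ⟨a', ha', hale⟩ := exists_repr_mul_torusX hQ hH ha d l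
    obtain ⟨b', hb', hble⟩ := exists_repr_mul_torusX hQ hH hb (-d) l
    obtain ⟨c, hc, hcle⟩ := exists_repr_mul_ne_zero (tDeg l) ha' hb'
    rw [← hfu, ← hgv, ← map_mul] at hc
    have h2 := (mem_supported.1 h1 c hc).1 l
    have h3 : (a' l).1 + (b' l).1 ≤ (c l).1 := hcle
    rw [Pi.neg_apply, neg_neg] at hble
    have h4 : |d l| = max 0 (-d l) + max 0 (d l) := by
      rcases abs_cases (d l) with h | h <;> omega
    rw [h4, mul_add]
    linarith

/-- A factorization of a polynomial in `tⱼ` into elements not commuting with `tⱼ` has large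
degree, and in the case of minimal degree the factors are `xⱼ` and `yⱼ` up to scalars. -/
theorem exists_eq_smul_xPow_of_mul_eq_aeval (hQ : ∀ i, Q i ≠ 0) (hH : ∀ i, 2 ≤ (H i).natDegree)
    {j : Fin r} {u v : TensorGWA Q H} {p : k[X]} (hp : p ≠ 0)
    (huv : u * v = gwaTensorEmb Q H j (aeval GWA.t p))
    {c : k} (hc : c ≠ 1) (hcomm : u * gwaTensorEmb Q H j GWA.t = c • (gwaTensorEmb Q H j GWA.t * u)) :
    (H j).natDegree ≤ p.natDegree ∧ (p.natDegree ≤ (H j).natDegree →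
      ∃ d : ℤ, |d| = 1 ∧ ∃ α β : k, α ≠ 0 ∧ β ≠ 0 ∧ u = α • xPow Q H (Pi.single j d) ∧
        v = β • xPow Q H (Pi.single j (-d))) := by
  have hH0 : ∀ i, H i ≠ 0 := fun i h0 => by simpa [h0] using hH i
  obtain ⟨d, f, hf, g, hg, hu, hv, hf0, hg0, hle⟩ := exists_factor_of_mul_eq_aeval hQ hH0 hp huv
  obtain ⟨a, ha⟩ := exists_repr_of_ne_zero hf0
  obtain ⟨b, hb⟩ := exists_repr_of_ne_zero hg0
  have hpos : ∀ l, (0 : ℤ) < (H l).natDegree := fun l => by have := hH l; omega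
  have hd : d = Pi.single j (d j) := by
    ext l
    by_cases hl : l = j
    · subst hl; simp
    · have h1 := hle a b ha hb l
      have h2 := (mem_supported.1 hf a ha l).1
      have h3 := (mem_supported.1 hg b hb l).1
      rw [Pi.single_eq_of_ne hl] at h1 ⊢
      have h4 : ((H l).natDegree : ℤ) * |d l| ≤ 0 := by linarith
      have h5 : |d l| ≤ 0 := by
        by_contra! h6
        exact absurd h4 (not_le.2 (mul_pos (hpos l) h6))
      exact abs_nonpos_iff.1 h5
  have hdj : d j ≠ 0 := by
    intro h0
    rw [h0, Pi.single_zero] at hd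
    rw [hd, torusX_zero, mul_one] at hu
    have h1 := congrArg (toPiTorus hQ H) hcomm
    rw [gwaTensorEmb_t, map_smul, map_mul, map_mul, hu, toPiTorus_tPow] at h1
    have h2 := basis_tExp_mem_tPoly hQ (Pi.single j 1)
    rw [commute_of_mem_tPoly hQ hf h2] at h1
    have h3 := smul_left_injective k (mul_ne_zero ((basis (piBichar hQ)).ne_zero
      (tExp fun i => ((Pi.single j 1 : Fin r → ℕ) i : ℤ))) hf0) ((one_smul k _).trans h1)
    exact hc h3.symm
  have habs : 1 ≤ |d j| := Int.one_le_abs hdj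
  have hj : ∀ a b, (basis _).repr f a ≠ 0 → (basis _).repr g b ≠ 0 →
      (a j).1 + (b j).1 + (H j).natDegree * |d j| ≤ p.natDegree := fun a b ha hb => by
    simpa using hle a b ha hb j
  constructor
  · have h1 := hj a b ha hb
    have h2 := (mem_supported.1 hf a ha j).1
    have h3 := (mem_supported.1 hg b hb j).1
    have h4 := le_mul_of_one_le_right (hpos j).le habs
    omega
  · intro hpj
    have h1 : ∀ a b, (basis _).repr f a ≠ 0 → (basis _).repr g b ≠ 0 →
        a = 0 ∧ b = 0 ∧ |d j| = 1 := by
      intro a b ha hb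
      have h2 := mem_supported.1 hf a ha
      have h3 := mem_supported.1 hg b hb
      have h4 := hj a b ha hb
      have h5 := le_mul_of_one_le_right (hpos j).le habs
      have h7 : ∀ l, (a l).1 = 0 ∧ (b l).1 = 0 := by
        intro l
        have h8 := (h2 l).1
        have h9 := (h3 l).1
        by_cases hl : l = j
        · subst hl; omega
        · have h10 := hle a b ha hb l
          rw [Pi.single_eq_of_ne hl] at h10
          have h11 := mul_nonneg (hpos l).le (abs_nonneg (d l))
          omega
      refine ⟨funext fun l => Prod.ext (h7 l).1 (h2 l).2, funext fun l => Prod.ext (h7 l).2 (h3 l).2,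
        le_antisymm ?_ habs⟩
      have h12 := h7 j
      by_contra! h13
      have h14 : ((H j).natDegree : ℤ) * 2 ≤ (H j).natDegree * |d j| :=
        mul_le_mul_of_nonneg_left h13 (hpos j).le
      have := hpos j
      omega
    have hα := (h1 a b ha hb).1 ▸ ha
    have hβ := (h1 a b ha hb).2.1 ▸ hb
    have hf1 := eq_repr_zero_smul_one fun a ha => (h1 a b ha hb).1
    have hg1 := eq_repr_zero_smul_one fun b hb => (h1 a b ha hb).2.1
    refine ⟨d j, (h1 a b ha hb).2.2, _, _, hα, hβ, toPiTorus_injective hQ hH0 ?_,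
      toPiTorus_injective hQ hH0 ?_⟩
    · rw [map_smul, hu, ← hd]
      conv_lhs => rw [hf1]
      rw [smul_mul_assoc, one_mul, torusX]
    · rw [map_smul, hv, Pi.single_neg, ← hd]
      conv_lhs => rw [hg1]
      rw [smul_mul_assoc, one_mul, torusX]

end PolynomialFactors

/-! ### Images of the tensor factors -/

section Factors

variable {r : ℕ} {Q : Fin r → k} {H : Fin r → k[X]}

theorem gwaTensorEmb_smul (i : Fin r) (c : k) (w : GWA.One (Q i) (H i)) :
    gwaTensorEmb Q H i (c • w) = c • gwaTensorEmb Q H i w := by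
  rw [← gwaTensorEmbHom_apply, ← gwaTensorEmbHom_apply, map_smul]

theorem gwaTensorEmb_mul (i : Fin r) (w w' : GWA.One (Q i) (H i)) :
    gwaTensorEmb Q H i (w * w') = gwaTensorEmb Q H i w * gwaTensorEmb Q H i w' := by
  rw [← gwaTensorEmbHom_apply, ← gwaTensorEmbHom_apply, ← gwaTensorEmbHom_apply, map_mul]

theorem map_gwaTensorEmb_aeval_t (φ : TensorGWA Q H ≃ₐ[k] TensorGWA Q H) {i j : Fin r} {γ : k}
    (ht : φ (gwaTensorEmb Q H i GWA.t) = γ • gwaTensorEmb Q H j GWA.t) (p : k[X]) :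
    φ (gwaTensorEmb Q H i (aeval GWA.t p)) =
      gwaTensorEmb Q H j (aeval GWA.t (p.comp (C γ * X))) := by
  rw [← GWA.aeval_smul_t]
  rw [← gwaTensorEmbHom_apply, ← gwaTensorEmbHom_apply, ← aeval_algHom_apply, ← aeval_algHom_apply,
    ← aeval_algHom_apply, gwaTensorEmbHom_apply, ht, gwaTensorEmbHom_apply, gwaTensorEmb_smul]

theorem map_gwaTensorEmb_mem_range (φ : TensorGWA Q H ≃ₐ[k] TensorGWA Q H) {i j : Fin r}
    (hx : φ (gwaTensorEmb Q H i (GWA.x 0)) ∈ Set.range (gwaTensorEmb Q H j))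
    (hy : φ (gwaTensorEmb Q H i (GWA.y 0)) ∈ Set.range (gwaTensorEmb Q H j))
    (ht : φ (gwaTensorEmb Q H i GWA.t) ∈ Set.range (gwaTensorEmb Q H j))
    (w : GWA.One (Q i) (H i)) :
    φ (gwaTensorEmb Q H i w) ∈ Set.range (gwaTensorEmb Q H j) := by
  have hr : Set.range (gwaTensorEmb Q H j) = (gwaTensorEmbHom Q H j).range := by
    ext u
    simp only [Set.mem_range, SetLike.mem_coe, AlgHom.mem_range, gwaTensorEmbHom_apply]
  rw [hr, SetLike.mem_coe] at *
  let ψ : GWA.One (Q i) (H i) →ₐ[k] TensorGWA Q H := (φ : _ →ₐ[k] _).comp (gwaTensorEmbHom Q H i)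
  have hψ : ∀ w, ψ w = φ (gwaTensorEmb Q H i w) := fun w =>
    congrArg φ (gwaTensorEmbHom_apply Q H i w)
  rw [← hψ] at *
  have key : ∀ a, ψ a ∈ (gwaTensorEmbHom Q H j).range →
      ∀ w ∈ Subalgebra.toSubmodule ((gwaTensorEmbHom Q H j).range.comap ψ),
        a * w ∈ Subalgebra.toSubmodule ((gwaTensorEmbHom Q H j).range.comap ψ) := by
    intro a ha w hw
    rw [Subalgebra.mem_toSubmodule] at hw ⊢
    exact mul_mem (S := Subalgebra k (GWA.One (Q i) (H i))) ha hw
  exact GWA.induction_left (S := Subalgebra.toSubmodule ((gwaTensorEmbHom Q H j).range.comap ψ))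
    (one_mem ((gwaTensorEmbHom Q H j).range.comap ψ)) (key _ hx) (key _ hy) (key _ ht) w

theorem natDegree_le_of_map_t (hQ : ∀ i, Q i ≠ 0) (hQ1 : ∀ i, Q i ≠ 1)
    (hH : ∀ i, 2 ≤ (H i).natDegree) (φ : TensorGWA Q H ≃ₐ[k] TensorGWA Q H) {i j : Fin r} {γ : k}
    (hγ : γ ≠ 0) (ht : φ (gwaTensorEmb Q H i GWA.t) = γ • gwaTensorEmb Q H j GWA.t) :
    (H j).natDegree ≤ (H i).natDegree ∧ ((H i).natDegree ≤ (H j).natDegree →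
      ∃ d : ℤ, |d| = 1 ∧ ∃ α β : k, α ≠ 0 ∧ β ≠ 0 ∧
        φ (gwaTensorEmb Q H i (GWA.x 0)) = α • xPow Q H (Pi.single j d) ∧
        φ (gwaTensorEmb Q H i (GWA.y 0)) = β • xPow Q H (Pi.single j (-d))) := by
  have hdeg : ((H i).comp (C γ * X)).natDegree = (H i).natDegree := by
    rw [natDegree_comp, natDegree_C_mul_X γ hγ, mul_one]
  have hp : (H i).comp (C γ * X) ≠ 0 := by
    intro h0
    rw [h0, natDegree_zero] at hdeg
    have := hH i
    omega
  have huv : φ (gwaTensorEmb Q H i (GWA.x 0)) * φ (gwaTensorEmb Q H i (GWA.y 0)) =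
      gwaTensorEmb Q H j (aeval GWA.t ((H i).comp (C γ * X))) := by
    rw [← map_mul, ← gwaTensorEmb_mul, GWA.x_mul_y, map_gwaTensorEmb_aeval_t φ ht]
  have hcomm : φ (gwaTensorEmb Q H i (GWA.x 0)) * gwaTensorEmb Q H j GWA.t =
      Q i • (gwaTensorEmb Q H j GWA.t * φ (gwaTensorEmb Q H i (GWA.x 0))) := by
    have h1 : gwaTensorEmb Q H j GWA.t = γ⁻¹ • φ (gwaTensorEmb Q H i GWA.t) := by
      rw [eq_inv_smul_iff₀ hγ, ht]
    rw [h1, tensorGWA_mul_smul, tensorGWA_smul_mul, ← map_mul, ← map_mul, ← gwaTensorEmb_mul,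
      ← gwaTensorEmb_mul, GWA.x_mul_t, gwaTensorEmb_smul, map_smul, smul_comm]
  have h2 := exists_eq_smul_xPow_of_mul_eq_aeval hQ hH hp huv (hQ1 i) hcomm
  rwa [hdeg] at h2

theorem exists_map_generators (hQ : ∀ i, Q i ≠ 0) (hQ1 : ∀ i, Q i ≠ 1)
    (hH : ∀ i, 2 ≤ (H i).natDegree) (φ : TensorGWA Q H ≃ₐ[k] TensorGWA Q H) {i j : Fin r} {γ : k}
    (hγ : γ ≠ 0) (ht : φ (gwaTensorEmb Q H i GWA.t) = γ • gwaTensorEmb Q H j GWA.t) :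
    ∃ α β : k, α ≠ 0 ∧ β ≠ 0 ∧
      ((φ (gwaTensorEmb Q H i (GWA.x 0)) = α • gwaTensorEmb Q H j (GWA.x 0) ∧
        φ (gwaTensorEmb Q H i (GWA.y 0)) = β • gwaTensorEmb Q H j (GWA.y 0) ∧
        (H i).comp (C γ * X) = C (α * β) * H j) ∨
       (φ (gwaTensorEmb Q H i (GWA.x 0)) = α • gwaTensorEmb Q H j (GWA.y 0) ∧
        φ (gwaTensorEmb Q H i (GWA.y 0)) = β • gwaTensorEmb Q H j (GWA.x 0) ∧
        (H i).comp (C γ * X) = C (α * β) * (H j).comp (C (Q j)⁻¹ * X))) := by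
  have hsymm : φ.symm (gwaTensorEmb Q H j GWA.t) = γ⁻¹ • gwaTensorEmb Q H i GWA.t := by
    rw [eq_inv_smul_iff₀ hγ, ← map_smul, ← ht, AlgEquiv.symm_apply_apply]
  obtain ⟨d, hd, α, β, hα, hβ, hx, hy⟩ := (natDegree_le_of_map_t hQ hQ1 hH φ hγ ht).2
    (natDegree_le_of_map_t hQ hQ1 hH φ.symm (inv_ne_zero hγ) hsymm).1
  have key : ∀ (w w' : GWA.One (Q j) (H j)) (p : k[X]), w * w' = aeval GWA.t p →
      φ (gwaTensorEmb Q H i (GWA.x 0)) = α • gwaTensorEmb Q H j w →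
      φ (gwaTensorEmb Q H i (GWA.y 0)) = β • gwaTensorEmb Q H j w' →
      (H i).comp (C γ * X) = C (α * β) * p := by
    intro w w' p hw hx hy
    refine aeval_t_injective (H := H) hQ j ?_
    rw [← map_gwaTensorEmb_aeval_t φ ht, ← GWA.x_mul_y, gwaTensorEmb_mul, map_mul, hx, hy,
      tensorGWA_smul_mul, tensorGWA_mul_smul, smul_smul, ← gwaTensorEmb_mul, hw, ← smul_eq_C_mul,
      map_smul, gwaTensorEmb_smul]
  refine ⟨α, β, hα, hβ, ?_⟩
  rcases (abs_eq zero_le_one).1 hd with rfl | rfl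
  · rw [← gwaTensorEmb_x] at hx
    rw [← gwaTensorEmb_y] at hy
    exact Or.inl ⟨hx, hy, key _ _ _ GWA.x_mul_y hx hy⟩
  · rw [← gwaTensorEmb_y] at hx
    rw [neg_neg, ← gwaTensorEmb_x] at hy
    exact Or.inr ⟨hx, hy, key _ _ _ (GWA.y_mul_x.trans (GWA.aeval_smul_t _ _)) hx hy⟩

theorem map_gwaTensorEmb_mem_range_of_map_t (hQ : ∀ i, Q i ≠ 0) (hQ1 : ∀ i, Q i ≠ 1)
    (hH : ∀ i, 2 ≤ (H i).natDegree) (φ : TensorGWA Q H ≃ₐ[k] TensorGWA Q H) {i j : Fin r} {γ : k}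
    (hγ : γ ≠ 0) (ht : φ (gwaTensorEmb Q H i GWA.t) = γ • gwaTensorEmb Q H j GWA.t)
    (w : GWA.One (Q i) (H i)) :
    φ (gwaTensorEmb Q H i w) ∈ Set.range (gwaTensorEmb Q H j) := by
  have hsmul : ∀ (α : k) (w' : GWA.One (Q j) (H j)),
      α • gwaTensorEmb Q H j w' ∈ Set.range (gwaTensorEmb Q H j) :=
    fun α w' => ⟨α • w', gwaTensorEmb_smul j α w'⟩
  obtain ⟨α, β, -, -, ⟨hx, hy, -⟩ | ⟨hx, hy, -⟩⟩ := exists_map_generators hQ hQ1 hH φ hγ ht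
  all_goals exact map_gwaTensorEmb_mem_range φ (hx ▸ hsmul _ _) (hy ▸ hsmul _ _) (ht ▸ hsmul _ _) w

theorem image_range_gwaTensorEmb (hQ : ∀ i, Q i ≠ 0) (hQ1 : ∀ i, Q i ≠ 1)
    (hH : ∀ i, 2 ≤ (H i).natDegree) (φ : TensorGWA Q H ≃ₐ[k] TensorGWA Q H) {i j : Fin r} {γ : k}
    (hγ : γ ≠ 0) (ht : φ (gwaTensorEmb Q H i GWA.t) = γ • gwaTensorEmb Q H j GWA.t) :
    φ '' Set.range (gwaTensorEmb Q H i) = Set.range (gwaTensorEmb Q H j) := by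
  have hsymm : φ.symm (gwaTensorEmb Q H j GWA.t) = γ⁻¹ • gwaTensorEmb Q H i GWA.t := by
    rw [eq_inv_smul_iff₀ hγ, ← map_smul, ← ht, AlgEquiv.symm_apply_apply]
  refine Set.Subset.antisymm ?_ ?_
  · rintro _ ⟨_, ⟨w, rfl⟩, rfl⟩
    exact map_gwaTensorEmb_mem_range_of_map_t hQ hQ1 hH φ hγ ht w
  · rintro _ ⟨w, rfl⟩
    exact ⟨_, map_gwaTensorEmb_mem_range_of_map_t hQ hQ1 hH φ.symm (inv_ne_zero hγ) hsymm w,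
      AlgEquiv.apply_symm_apply _ _⟩

theorem exists_perm_map_t (hH : ∀ i, 2 ≤ (H i).natDegree) (hfin : ∀ i, IsOfFinOrder (Q i))
    (hQ1 : ∀ i, Q i ≠ 1) (φ : TensorGWA Q H ≃ₐ[k] TensorGWA Q H) :
    ∃ (τ : Equiv.Perm (Fin r)) (γ : Fin r → k), ∀ i, γ i ≠ 0 ∧
      φ (gwaTensorEmb Q H i GWA.t) = γ i • gwaTensorEmb Q H (τ i) GWA.t := by
  have hQ : ∀ i, Q i ≠ 0 := fun i => (hfin i).isUnit.ne_zero
  choose τ γ hγ ht using exists_map_tPow_single hH hfin hQ1 φ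
  have hinj : Function.Injective τ := by
    intro i i' hii
    have h1 : γ i' • tPow Q H (Pi.single i 1) = γ i • tPow Q H (Pi.single i' 1) := by
      apply φ.injective
      rw [map_smul, map_smul, ht, ht, hii, smul_comm]
    have h2 := congrFun (tPow_eq_of_smul_eq_smul hQ (hγ i') h1) i
    by_contra hne
    simp [hne] at h2
  refine ⟨Equiv.ofBijective τ (Finite.injective_iff_bijective.1 hinj), γ, fun i => ⟨hγ i, ?_⟩⟩
  rw [gwaTensorEmb_t, gwaTensorEmb_t]
  exact ht i

end Factors

/-- Proposition 6.3. Let `W₁, …, W_r` be degree one quantum GWAs with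
parameters `(qᵢ, hᵢ)`, each `qᵢ` a root of unity with `qᵢ² ≠ 1` and each `hᵢ` of degree
`≥ 2`, and let `A = W₁ ⊗ₖ ⋯ ⊗ₖ W_r` with canonical embeddings `ιᵢ`.  Every `k`-algebra
automorphism `φ` of `A` permutes the factors: there is a permutation `τ` with
`φ(ιᵢ(Wᵢ)) = ι_{τ(i)}(W_{τ(i)})`, and scalars `αᵢ, βᵢ, γᵢ ∈ kˣ` such that
`φ(ιᵢ(tᵢ)) = γᵢ·ι_{τ(i)}(t_{τ(i)})` and either
`φ(ιᵢ(xᵢ)) = αᵢ·ι_{τ(i)}(x_{τ(i)})`, `φ(ιᵢ(yᵢ)) = βᵢ·ι_{τ(i)}(y_{τ(i)})` with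
`hᵢ(γᵢ t) = αᵢβᵢ·h_{τ(i)}(t)`, or
`φ(ιᵢ(xᵢ)) = αᵢ·ι_{τ(i)}(y_{τ(i)})`, `φ(ιᵢ(yᵢ)) = βᵢ·ι_{τ(i)}(x_{τ(i)})` with
`hᵢ(γᵢ t) = αᵢβᵢ·h_{τ(i)}(q_{τ(i)}⁻¹ t)`. -/
theorem automorphisms_of_tensor_product_of_quantum_GWAs
    (k : Type*) [Field k] (r : ℕ) (Q : Fin r → k) (H : Fin r → Polynomial k)
    (hQ : ∀ i, IsOfFinOrder (Q i)) (hQ2 : ∀ i, (Q i) ^ 2 ≠ 1)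
    (hH : ∀ i, 2 ≤ (H i).natDegree)
    (φ : (⨂[k] j : Fin r, GWA k 1 (fun _ => Q j) (fun _ => H j)) ≃ₐ[k]
          ⨂[k] j : Fin r, GWA k 1 (fun _ => Q j) (fun _ => H j)) :
    ∃ τ : Equiv.Perm (Fin r),
      (∀ i, φ '' Set.range (gwaTensorEmb Q H i) = Set.range (gwaTensorEmb Q H (τ i))) ∧
      (∀ i, ∃ α β γ : kˣ,
        φ (gwaTensorEmb Q H i GWA.t) = (γ : k) • gwaTensorEmb Q H (τ i) GWA.t ∧
        ((φ (gwaTensorEmb Q H i (GWA.x 0)) = (α : k) • gwaTensorEmb Q H (τ i) (GWA.x 0) ∧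
          φ (gwaTensorEmb Q H i (GWA.y 0)) = (β : k) • gwaTensorEmb Q H (τ i) (GWA.y 0) ∧
          (H i).comp (C (γ : k) * X) = C ((α : k) * (β : k)) * H (τ i)) ∨
         (φ (gwaTensorEmb Q H i (GWA.x 0)) = (α : k) • gwaTensorEmb Q H (τ i) (GWA.y 0) ∧
          φ (gwaTensorEmb Q H i (GWA.y 0)) = (β : k) • gwaTensorEmb Q H (τ i) (GWA.x 0) ∧
          (H i).comp (C (γ : k) * X)
            = C ((α : k) * (β : k)) * ((H (τ i)).comp (C (Q (τ i))⁻¹ * X))))) := by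
  have hQ0 : ∀ i, Q i ≠ 0 := fun i => (hQ i).isUnit.ne_zero
  have hQ1 : ∀ i, Q i ≠ 1 := fun i h => hQ2 i (by rw [h, one_pow])
  obtain ⟨τ, γ, hτ⟩ := exists_perm_map_t hH hQ hQ1 φ
  refine ⟨τ, fun i => image_range_gwaTensorEmb hQ0 hQ1 hH φ (hτ i).1 (hτ i).2, fun i => ?_⟩
  obtain ⟨α, β, hα, hβ, h1⟩ := exists_map_generators hQ0 hQ1 hH φ (hτ i).1 (hτ i).2
  exact ⟨Units.mk0 α hα, Units.mk0 β hβ, Units.mk0 (γ i) (hτ i).1, (hτ i).2, h1⟩
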